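/- arXiv:2605.08848 — 3 statements merged into one kernel-verified Lean document; each statement's English description precedes it below -/
import Mathlib

section
/- Let h ≥ 1 and t ≥ 1 be integers, let d ≥ t be a real number, and let c ∈ (0, 1/2) be real. Then for every (c,t)-sparse graph G, either (i) G has an induced subgraph J with |E(J)|/|V(J)| ≥ |E(G)|/|V(G)| − 2·(4/c)^(h+1)·d such that J contains no ((4/c)^(h+1)·d, h)-skeleton, or (ii) G contains a (d, h+1)-skeleton. -/
open SimpleGraph

/-- The number of ordered pairs `(a,b) ∈ A × B` forming an edge of `G`. -/
noncomputable def eCount {V : Type*} (G : SimpleGraph V) (A B : Finset V) : ℕ :=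
  Set.ncard {p : V × V | p.1 ∈ A ∧ p.2 ∈ B ∧ G.Adj p.1 p.2}

/-- A graph is `(c,t)`-sparse if every two vertex subsets of size at least `t`
span at most a `(1-c)` fraction of the possible ordered adjacent pairs. -/
def CTSparse {V : Type*} [Fintype V] (G : SimpleGraph V) (c : ℝ) (t : ℕ) : Prop :=
  ∀ A B : Finset V, t ≤ A.card → t ≤ B.card →
    (eCount G A B : ℝ) ≤ (1 - c) * A.card * B.card

/-- `v` is a child of `u` in the tree `T` rooted at `r`. -/
def IsChild {V : Type*} (T : SimpleGraph V) (r u v : V) : Prop :=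
  T.Adj u v ∧ T.dist r v = T.dist r u + 1

/-- The depth of the tree `T` rooted at `r`: the maximum height of a vertex. -/
noncomputable def rootDepth {V : Type*} (T : SimpleGraph V) (r : V) : ℕ :=
  sSup (Set.range (T.dist r))

/-- The rooted tree `(T,r)` is `(d,h)`-wide: its depth is `h` and every vertex
of height less than `h` has at least `d` children. -/
def IsWide {V : Type*} (T : SimpleGraph V) (r : V) (d : ℝ) (h : ℕ) : Prop :=
  rootDepth T r = h ∧
  ∀ u : V, T.dist r u < h → d ≤ (Set.ncard {v : V | IsChild T r u v} : ℝ)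

/-- A leaf of the rooted tree `(T,r)`: a non-root vertex with no children. -/
def IsTreeLeaf {V : Type*} (T : SimpleGraph V) (r l : V) : Prop :=
  l ≠ r ∧ ∀ v : V, ¬ IsChild T r l v

/-- `x` lies on the (unique) path from `r` to `l` in the tree `T`. -/
def OnRootPath {V : Type*} (T : SimpleGraph V) (r l x : V) : Prop :=
  T.dist r x + T.dist x l = T.dist r l

/-- A skeleton from the rooted tree `(T,r)` to `G`: a locally injective
homomorphism mapping every root-to-leaf path of `(T,r)` onto an induced path
of `G`. -/
def IsSkeleton {V W : Type*} (T : SimpleGraph V) (r : V) (G : SimpleGraph W)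
    (φ : T →g G) : Prop :=
  (∀ v : V, Set.InjOn φ (T.neighborSet v)) ∧
  ∀ l : V, IsTreeLeaf T r l →
    Set.InjOn φ {x : V | OnRootPath T r l x} ∧
    ∀ x y : V, OnRootPath T r l x → OnRootPath T r l y →
      (G.Adj (φ x) (φ y) ↔ T.Adj x y)

/-- `G` contains a `(d,h)`-skeleton: a skeleton from some `(d,h)`-wide finite
rooted tree to `G`. -/
def HasSkeleton {W : Type*} (G : SimpleGraph W) (d : ℝ) (h : ℕ) : Prop :=
  ∃ (V : Type) (_ : Fintype V) (T : SimpleGraph V) (r : V),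
    T.IsTree ∧ IsWide T r d h ∧ ∃ φ : T →g G, IsSkeleton T r G φ

/-- The edge-to-vertex ratio `|E(G)|/|V(G)|` of a graph (half its average
degree). -/
noncomputable def edgeVertexRatio {V : Type*} (G : SimpleGraph V) : ℝ :=
  (G.edgeSet.ncard : ℝ) / (Nat.card V : ℝ)


/-! ### Skeletons as prefix-closed families of induced paths -/

/-- `a` extends the (reversed) induced path `l`. -/
def ExtP {V : Type*} (G : SimpleGraph V) (a : V) : List V → Prop
  | [] => True
  | b :: m => G.Adj a b ∧ ∀ x ∈ m, x ≠ a ∧ ¬ G.Adj a x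

/-- The (reversed) path `l` can be extended by a `(d,k)`-wide tree of induced paths. -/
def PP {V : Type*} (G : SimpleGraph V) (d : ℝ) : ℕ → List V → Prop
  | 0, _ => True
  | k + 1, l => ∃ A : Finset V, d ≤ A.card ∧ ∀ a ∈ A, ExtP G a l ∧ PP G d k (a :: l)

lemma ExtP_append {V : Type*} (G : SimpleGraph V) (a v : V) (l : List V) (hl : l ≠ [])
    (h1 : ExtP G a l) (h2 : a ≠ v) (h3 : ¬ G.Adj a v) : ExtP G a (l ++ [v]) := by
  cases l with
  | nil => exact absurd rfl hl
  | cons b m =>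
    refine ⟨h1.1, ?_⟩
    intro x hx
    rcases List.mem_append.1 hx with hx | hx
    · exact h1.2 x hx
    · rw [List.mem_singleton] at hx
      subst hx
      exact ⟨h2.symm, h3⟩

lemma PP_map {V : Type*} (G : SimpleGraph V) (S : Set V) (d : ℝ) :
    ∀ k (l : List S), PP (G.induce S) d k l → PP G d k (l.map Subtype.val) := by
  classical
  intro k
  induction k with
  | zero => intro l _; trivial
  | succ k ih =>
    rintro l ⟨A, hA, h⟩
    refine ⟨A.map ⟨Subtype.val, Subtype.val_injective⟩, by simpa using hA, ?_⟩
    intro a' ha'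
    obtain ⟨a, ha, rfl⟩ := Finset.mem_map.1 ha'
    refine ⟨?_, ih _ (h a ha).2⟩
    have h1 := (h a ha).1
    cases l with
    | nil => trivial
    | cons b m =>
      refine ⟨h1.1, ?_⟩
      intro x' hx'
      obtain ⟨x, hx, rfl⟩ := List.mem_map.1 hx'
      have := h1.2 x hx
      exact ⟨fun hh => this.1 (Subtype.ext hh), this.2⟩

lemma exists_leaf {V : Type*} [Fintype V] (T : SimpleGraph V) (hT : T.Connected) (r a : V)
    (ha : a ≠ r) : ∃ l, IsTreeLeaf T r l ∧ OnRootPath T r l a := by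
  classical
  obtain ⟨l, hl, hmax⟩ := Finset.exists_max_image
    (Finset.univ.filter fun l => OnRootPath T r l a) (T.dist r)
    ⟨a, Finset.mem_filter.2 ⟨Finset.mem_univ _, by simp [OnRootPath]⟩⟩
  simp only [Finset.mem_filter, Finset.mem_univ, true_and] at hl hmax
  refine ⟨l, ⟨?_, ?_⟩, hl⟩
  · rintro rfl
    unfold OnRootPath at hl
    have := hT.pos_dist_of_ne ha
    rw [SimpleGraph.dist_self] at hl
    omega
  · rintro v ⟨hv, hv2⟩
    have h1 : OnRootPath T r v a := by
      unfold OnRootPath at hl ⊢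
      have h2 := hT.dist_triangle (u := r) (v := a) (w := v)
      have h3 := hT.dist_triangle (u := a) (v := l) (w := v)
      have h4 : T.dist l v = 1 := SimpleGraph.dist_eq_one_iff_adj.2 hv
      omega
    have := hmax v h1
    omega

lemma PP_of_tree {V W : Type*} [Fintype V] (T : SimpleGraph V) (hT : T.Connected) (r : V)
    (G : SimpleGraph W) (φ : T →g G) (hφ : IsSkeleton T r G φ) (d : ℝ) (h : ℕ)
    (hw : IsWide T r d h) :
    ∀ k x (m : List V), T.dist r x + k = h →
      (∀ y ∈ m, T.dist r y < T.dist r x ∧ OnRootPath T r x y) →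
      PP G d k ((x :: m).map φ) := by
  classical
  intro k
  induction k with
  | zero => intros; trivial
  | succ k ih =>
    intro x m hx hm
    have hwx := hw.2 x (by omega)
    refine ⟨(Finset.univ.filter fun v => IsChild T r x v).image φ, ?_, ?_⟩
    · rw [Finset.card_image_of_injOn]
      · rw [← Set.ncard_coe_finset]
        simpa using hwx
      · intro a ha b hb hab
        simp only [Finset.coe_filter, Finset.mem_univ, true_and, Set.mem_ofPred_eq] at ha hb
        exact hφ.1 x ha.1 hb.1 hab
    · intro a' ha'
      obtain ⟨a, ha, rfl⟩ := Finset.mem_image.1 ha'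
      simp only [Finset.mem_filter, Finset.mem_univ, true_and] at ha
      obtain ⟨hxa, hda⟩ := ha
      have h1 : T.dist x a = 1 := SimpleGraph.dist_eq_one_iff_adj.2 hxa
      have key : ∀ y ∈ m, T.dist r y < T.dist r x ∧ OnRootPath T r a y := by
        intro y hy
        obtain ⟨h2, h3⟩ := hm y hy
        refine ⟨h2, ?_⟩
        unfold OnRootPath at h3 ⊢
        have h4 := hT.dist_triangle (u := r) (v := y) (w := a)
        have h5 := hT.dist_triangle (u := y) (v := x) (w := a)
        omega
      constructor
      · refine ⟨(φ.map_adj hxa).symm, ?_⟩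
        intro z hz
        obtain ⟨y, hy, rfl⟩ := List.mem_map.1 hz
        have hy' := key y hy
        obtain ⟨l, hl, hla⟩ := exists_leaf T hT r a (by
          rintro rfl
          simp at hda)
        have hly : OnRootPath T r l y := by
          have h3 := hy'.2
          unfold OnRootPath at h3 hla ⊢
          have h4 := hT.dist_triangle (u := r) (v := y) (w := l)
          have h5 := hT.dist_triangle (u := y) (v := a) (w := l)
          omega
        obtain ⟨hinj, hadj⟩ := hφ.2 l hl
        constructor
        · intro hh
          have := hinj hly hla hh
          subst this
          omega
        · rw [hadj a y hla hly]
          intro hh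
          have h4 : T.dist y a = 1 := SimpleGraph.dist_eq_one_iff_adj.2 hh.symm
          have h3 := hy'.2
          unfold OnRootPath at h3
          omega
      · refine ih a (x :: m) (by omega) ?_
        intro y hy
        rcases List.mem_cons.1 hy with rfl | hy
        · refine ⟨by omega, ?_⟩
          unfold OnRootPath
          omega
        · have := key y hy
          exact ⟨by omega, this.2⟩

lemma PP_of_hasSkeleton {W : Type*} (G : SimpleGraph W) (d : ℝ) (h : ℕ)
    (hs : HasSkeleton G d h) : ∃ w, PP G d h [w] := by
  obtain ⟨V, _, T, r, hT, hw, φ, hφ⟩ := hs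
  exact ⟨φ r, PP_of_tree T hT.connected r G φ hφ d h hw h r [] (by simp) (by simp)⟩

/-! ### The tree of a prefix-closed family of lists -/

/-- Parent-child graph on a family of lists. -/
def listGraph {V : Type} (N : List V → Prop) : SimpleGraph {l : List V // N l} where
  Adj x y := (∃ a, x.1 = a :: y.1) ∨ (∃ a, y.1 = a :: x.1)
  symm := ⟨fun _ _ h => h.symm⟩
  loopless := ⟨fun x h => by
    rcases h with ⟨a, h⟩ | ⟨a, h⟩ <;> exact absurd (congrArg List.length h) (by simp)⟩

lemma listGraph_walk {V : Type} (N : List V → Prop) (v : V) (hv : N [v]) (h0 : ¬ N [])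
    (h1 : ∀ a, N [a] → a = v) (h2 : ∀ a b m, N (a :: b :: m) → N (b :: m)) : ∀ (l : List V) (hl : N l),
    ∃ w : (listGraph N).Walk ⟨[v], hv⟩ ⟨l, hl⟩, w.length + 1 = l.length := by
  intro l
  induction l with
  | nil => intro hl; exact absurd hl h0
  | cons a m ih =>
    intro hl
    cases m with
    | nil =>
      have := h1 a hl
      subst this
      exact ⟨SimpleGraph.Walk.nil, rfl⟩
    | cons b m =>
      obtain ⟨w, hw⟩ := ih (h2 a b m hl)
      have hadj : (listGraph N).Adj ⟨b :: m, h2 a b m hl⟩ ⟨a :: b :: m, hl⟩ := Or.inr ⟨a, rfl⟩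
      refine ⟨w.concat hadj, ?_⟩
      rw [SimpleGraph.Walk.length_concat, hw]
      rfl

lemma listGraph_walk_le {V : Type} (N : List V → Prop) : ∀ (x y : {l : List V // N l}) (w : (listGraph N).Walk x y),
    y.1.length ≤ x.1.length + w.length ∧
    (y.1.length = x.1.length + w.length → x.1 <:+ y.1) := by
  intro x y w
  induction w with
  | nil => simp
  | @cons x z y hxz w ih =>
    rw [SimpleGraph.Walk.length_cons]
    rcases hxz with ⟨a, ha⟩ | ⟨a, ha⟩
    · have := congrArg List.length ha
      simp only [List.length_cons] at this
      refine ⟨by omega, fun hh => by omega⟩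
    · have := congrArg List.length ha
      simp only [List.length_cons] at this
      refine ⟨by omega, fun hh => ?_⟩
      have h3 := ih.2 (by omega)
      rw [ha] at h3
      exact (List.suffix_cons a x.1).trans h3

lemma listGraph_conn {V : Type} (N : List V → Prop) (v : V) (hv : N [v]) (h0 : ¬ N [])
    (h1 : ∀ a, N [a] → a = v) (h2 : ∀ a b m, N (a :: b :: m) → N (b :: m)) : (listGraph N).Connected := by
  rw [SimpleGraph.connected_iff_exists_forall_reachable]
  refine ⟨⟨[v], hv⟩, ?_⟩
  rintro ⟨l, hl⟩
  obtain ⟨w, -⟩ := listGraph_walk N v hv h0 h1 h2 l hl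
  exact ⟨w⟩

lemma listGraph_dist {V : Type} (N : List V → Prop) (v : V) (hv : N [v]) (h0 : ¬ N [])
    (h1 : ∀ a, N [a] → a = v) (h2 : ∀ a b m, N (a :: b :: m) → N (b :: m)) (x : {l : List V // N l}) :
    (listGraph N).dist ⟨[v], hv⟩ x + 1 = x.1.length := by
  obtain ⟨l, hl⟩ := x
  obtain ⟨w, hw⟩ := listGraph_walk N v hv h0 h1 h2 l hl
  have h3 := SimpleGraph.dist_le w
  obtain ⟨w', hw'⟩ := (listGraph_conn N v hv h0 h1 h2).exists_walk_length_eq_dist ⟨[v], hv⟩ ⟨l, hl⟩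
  have h4 := (listGraph_walk_le N _ _ w').1
  simp only [List.length_singleton] at h4 ⊢
  omega

lemma listGraph_onRootPath {V : Type} (N : List V → Prop) (v : V) (hv : N [v]) (h0 : ¬ N [])
    (h1 : ∀ a, N [a] → a = v) (h2 : ∀ a b m, N (a :: b :: m) → N (b :: m)) (l x : {l : List V // N l})
    (h : OnRootPath (listGraph N) ⟨[v], hv⟩ l x) : x.1 <:+ l.1 := by
  obtain ⟨w', hw'⟩ := (listGraph_conn N v hv h0 h1 h2).exists_walk_length_eq_dist x l
  have h4 := (listGraph_walk_le N _ _ w').2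
  apply h4
  unfold OnRootPath at h
  have h5 := listGraph_dist N v hv h0 h1 h2 x
  have h6 := listGraph_dist N v hv h0 h1 h2 l
  omega

lemma listGraph_tree {V : Type} (N : List V → Prop) (v : V) (hv : N [v]) (h0 : ¬ N [])
    (h1 : ∀ a, N [a] → a = v) (h2 : ∀ a b m, N (a :: b :: m) → N (b :: m)) [Finite {l : List V // N l}] : (listGraph N).IsTree := by
  classical
  rw [SimpleGraph.isTree_iff_connected_and_card]
  refine ⟨listGraph_conn N v hv h0 h1 h2, ?_⟩
  have hp : ∀ x : {l : List V // N l}, x ≠ ⟨[v], hv⟩ →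
      ∃ y : {l : List V // N l}, ∃ a, x.1 = a :: y.1 := by
    rintro ⟨l, hl⟩ hx
    match l, hl, hx with
    | [], hl, _ => exact absurd hl h0
    | [a], hl, hx =>
      have := h1 a hl
      subst this
      exact absurd rfl hx
    | a :: b :: m, hl, _ => exact ⟨⟨b :: m, h2 a b m hl⟩, a, rfl⟩
  have hp' : ∀ x : {l : List V // N l}, ∃ y : {l : List V // N l}, x ≠ ⟨[v], hv⟩ →
      ∃ a, x.1 = a :: y.1 := by
    intro x
    by_cases hx : x = ⟨[v], hv⟩
    · exact ⟨x, fun h => absurd hx h⟩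
    · obtain ⟨y, hy⟩ := hp x hx
      exact ⟨y, fun _ => hy⟩
  choose p hpp using hp'
  have himg : (listGraph N).edgeSet = (fun x => s(x, p x)) '' {x | x ≠ ⟨[v], hv⟩} := by
    have aux : ∀ x y : {l : List V // N l}, (∃ a, x.1 = a :: y.1) →
        x ≠ ⟨[v], hv⟩ ∧ p x = y := by
      rintro x y ⟨a, ha⟩
      have hne : x ≠ ⟨[v], hv⟩ := by
        rintro rfl
        simp only [List.cons.injEq] at ha
        exact h0 (ha.2 ▸ y.2)
      refine ⟨hne, ?_⟩
      obtain ⟨b, hb⟩ := hpp x hne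
      rw [ha] at hb
      exact Subtype.ext (List.cons.inj hb).2.symm
    ext e
    induction e using Sym2.ind with
    | _ x y =>
      rw [SimpleGraph.mem_edgeSet]
      constructor
      · rintro (h | h)
        · obtain ⟨h3, h4⟩ := aux x y h
          exact ⟨x, h3, by simp only [h4]⟩
        · obtain ⟨h3, h4⟩ := aux y x h
          exact ⟨y, h3, by simp only [h4]; exact Sym2.eq_swap⟩
      · rintro ⟨z, hz, hzz⟩
        rw [← SimpleGraph.mem_edgeSet, ← hzz]
        exact Or.inl (hpp z hz)
  have hinj : Set.InjOn (fun x => s(x, p x)) {x : {l : List V // N l} | x ≠ ⟨[v], hv⟩} := by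
    intro x hx y hy hxy
    simp only [Sym2.eq_iff] at hxy
    rcases hxy with h | ⟨h3, h4⟩
    · exact h.1
    · obtain ⟨a, ha⟩ := hpp x hx
      obtain ⟨b, hb⟩ := hpp y hy
      rw [← h3] at hb
      rw [h4] at ha
      have e1 := congrArg List.length ha
      have e2 := congrArg List.length hb
      simp only [List.length_cons] at e1 e2
      omega
  have hcard : Nat.card (listGraph N).edgeSet = ({x : {l : List V // N l} | x ≠ ⟨[v], hv⟩}).ncard := by
    rw [Nat.card_coe_set_eq, himg, hinj.ncard_image]
  rw [hcard]
  have := Set.ncard_add_ncard_compl ({(⟨[v], hv⟩ : {l : List V // N l})} : Set _)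
  rw [Set.ncard_singleton] at this
  rw [← this, add_comm]
  rfl

/-- Lists obtained by repeatedly choosing elements from `A`. -/
def NN {V : Type} (v : V) (A : List V → Finset V) : List V → Prop
  | [] => False
  | [a] => a = v
  | a :: b :: m => a ∈ A (b :: m) ∧ NN v A (b :: m)

lemma hasSkeleton_of_PP {V : Type} [Fintype V] (G : SimpleGraph V) (d : ℝ) (hd : 0 < d) (h : ℕ)
    (v : V) (hP : PP G d h [v]) : HasSkeleton G d h := by
  classical
  have hA : ∀ l : List V, ∃ A : Finset V, (h < l.length → A = ∅) ∧
      (l.length ≤ h → PP G d (h + 1 - l.length) l → d ≤ A.card ∧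
        ∀ a ∈ A, ExtP G a l ∧ PP G d (h + 1 - (a :: l).length) (a :: l)) := by
    intro l
    by_cases hl : h < l.length
    · exact ⟨∅, fun _ => rfl, fun h' => by omega⟩
    · by_cases hq : PP G d (h + 1 - l.length) l
      · have : h + 1 - l.length = (h + 1 - (l.length + 1)) + 1 := by omega
        rw [this] at hq
        obtain ⟨A, hA1, hA2⟩ := hq
        exact ⟨A, fun h' => absurd h' hl, fun _ _ => ⟨hA1, hA2⟩⟩
      · exact ⟨∅, fun _ => rfl, fun _ h' => absurd h' hq⟩
  choose A hA1 hA2 using hA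
  have hv : NN v A [v] := rfl
  have h0 : ¬ NN v A [] := fun h => h
  have h1 : ∀ a, NN v A [a] → a = v := fun a h => h
  have h2 : ∀ a b m, NN v A (a :: b :: m) → NN v A (b :: m) := fun a b m h => h.2
  have hlen : ∀ l, NN v A l → l.length ≤ h + 1 ∧ PP G d (h + 1 - l.length) l := by
    intro l
    induction l with
    | nil => intro hl; exact absurd hl h0
    | cons a m ih =>
      intro hl
      cases m with
      | nil =>
        have := h1 a hl
        subst this
        exact ⟨by simp, by simpa using hP⟩
      | cons b m =>
        obtain ⟨i1, i2⟩ := ih hl.2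
        have hle : (b :: m).length ≤ h := by
          by_contra hcon
          have := hA1 (b :: m) (by omega)
          have h3 := hl.1
          rw [this] at h3
          simp at h3
        refine ⟨by rw [List.length_cons]; omega, ?_⟩
        exact ((hA2 _ hle i2).2 a hl.1).2
  have hext : ∀ a b m, NN v A (a :: b :: m) → ExtP G a (b :: m) := by
    intro a b m hl
    have hle := (hlen _ hl).1
    rw [List.length_cons] at hle
    exact ((hA2 (b :: m) (by omega) (hlen _ hl.2).2).2 a hl.1).1
  have hcons : ∀ a l, NN v A l → a ∈ A l → NN v A (a :: l) := by
    intro a l hl ha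
    cases l with
    | nil => exact absurd hl h0
    | cons b m => exact ⟨ha, hl⟩
  have hfin : Finite {l : List V // NN v A l} := by
    have : {l : List V | NN v A l}.Finite :=
      (List.finite_length_le V (h + 1)).subset fun l hl => (hlen l hl).1
    exact this
  have hne : ∀ x : {l : List V // NN v A l}, x.1 ≠ [] := by
    intro x hx
    exact h0 (hx ▸ x.2)
  have hdist := listGraph_dist (NN v A) v hv h0 h1 h2
  let φ : listGraph (NN v A) →g G :=
    { toFun := fun x => x.1.head (hne x)
      map_rel' := by
        have aux : ∀ x y : {l : List V // NN v A l}, (∃ a, x.1 = a :: y.1) →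
            G.Adj (x.1.head (hne x)) (y.1.head (hne y)) := by
          rintro ⟨x, hx⟩ ⟨y, hy⟩ ⟨a, ha⟩
          simp only at ha
          subst ha
          cases y with
          | nil => exact absurd hy h0
          | cons b m => exact (hext a b m hx).1
        intro x y hxy
        rcases hxy with hh | hh
        · exact aux x y hh
        · exact (aux y x hh).symm }
  have hφ : ∀ x : {l : List V // NN v A l}, φ x = x.1.head (hne x) := fun _ => rfl
  refine ⟨{l : List V // NN v A l}, Fintype.ofFinite _, listGraph (NN v A), ⟨[v], hv⟩,
    listGraph_tree _ v hv h0 h1 h2, ⟨?_, ?_⟩, φ, ?_, ?_⟩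
  · have hle : ∀ x, (listGraph (NN v A)).dist ⟨[v], hv⟩ x ≤ h := by
      intro x
      have := hdist x
      have := (hlen _ x.2).1
      omega
    have hex : ∀ j ≤ h, ∃ l, NN v A l ∧ l.length = j + 1 := by
      intro j
      induction j with
      | zero => intro _; exact ⟨[v], hv, rfl⟩
      | succ j ih =>
        intro hj
        obtain ⟨l, hl, hl2⟩ := ih (by omega)
        have h3 := (hA2 l (by omega) (hlen l hl).2).1
        have h4 : 0 < (A l).card := by
          have : (0 : ℝ) < (A l).card := lt_of_lt_of_le hd h3
          exact_mod_cast this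
        obtain ⟨a, ha⟩ := Finset.card_pos.1 h4
        exact ⟨a :: l, hcons a l hl ha, by simp [hl2]⟩
    obtain ⟨l, hl, hl2⟩ := hex h le_rfl
    apply IsGreatest.csSup_eq
    refine ⟨⟨⟨l, hl⟩, ?_⟩, ?_⟩
    · have := hdist ⟨l, hl⟩
      simp only at this
      omega
    · rintro _ ⟨x, rfl⟩
      exact hle x
  · intro x hx
    have hdx := hdist x
    obtain ⟨h3, h4⟩ := hA2 x.1 (by omega) (hlen x.1 x.2).2
    refine h3.trans ?_
    have : ((A x.1 : Set V)).ncard ≤ Set.ncard {y | IsChild (listGraph (NN v A)) ⟨[v], hv⟩ x y} := by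
      refine Set.ncard_le_ncard_of_injOn
        (fun a => if ha : a ∈ A x.1 then ⟨a :: x.1, hcons a x.1 x.2 ha⟩ else x) ?_ ?_ (Set.toFinite _)
      · intro a ha
        rw [Finset.mem_coe] at ha
        simp only [ha, dif_pos]
        refine ⟨Or.inr ⟨a, rfl⟩, ?_⟩
        have := hdist ⟨a :: x.1, hcons a x.1 x.2 ha⟩
        simp only [List.length_cons] at this
        omega
      · intro a ha b hb hab
        rw [Finset.mem_coe] at ha hb
        simp only [ha, hb, dif_pos] at hab
        exact (List.cons.inj (congrArg Subtype.val hab)).1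
    rw [Set.ncard_coe_finset] at this
    exact_mod_cast this
  · have aux : ∀ x y z : {l : List V // NN v A l}, (∃ a, x.1 = a :: y.1) → (∃ a, z.1 = a :: x.1) →
        φ y ≠ φ z := by
      rintro ⟨x, hx⟩ ⟨y, hy⟩ ⟨z, hz⟩ ⟨a, ha⟩ ⟨b, hb⟩
      simp only at ha hb
      subst ha
      subst hb
      cases y with
      | nil => exact absurd hy h0
      | cons e m =>
        simp only [hφ, List.head_cons]
        exact ((hext b a (e :: m) hz).2 e (by simp)).1
    intro x y hy z hz hyz
    rw [SimpleGraph.mem_neighborSet] at hy hz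
    rcases hy with hy | hy <;> rcases hz with hz | hz
    · obtain ⟨a, ha⟩ := hy
      obtain ⟨b, hb⟩ := hz
      rw [ha] at hb
      exact Subtype.ext (List.cons.inj hb).2
    · exact absurd hyz (aux x y z hy hz)
    · exact absurd hyz.symm (aux x z y hz hy)
    · obtain ⟨a, ha⟩ := hy
      obtain ⟨b, hb⟩ := hz
      simp only [hφ, ha, hb, List.head_cons] at hyz
      subst hyz
      exact Subtype.ext (ha.trans hb.symm)
  · intro l _
    have aux : ∀ x y : {l : List V // NN v A l}, x.1 <:+ y.1 → x ≠ y →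
        φ x ≠ φ y ∧ (G.Adj (φ x) (φ y) ↔ (listGraph (NN v A)).Adj x y) := by
      rintro ⟨x, hx⟩ ⟨y, hy⟩ hxy hne'
      simp only at hxy
      match y, hy, hxy, hne' with
      | [], hy, _, _ => exact absurd hy h0
      | [a], hy, hxy, hne' =>
        rcases List.suffix_cons_iff.1 hxy with h3 | h3
        · exact absurd (Subtype.ext h3) hne'
        · rw [List.suffix_nil] at h3
          exact absurd (h3 ▸ hx) h0
      | a :: b :: m, hy, hxy, hne' =>
        have he := hext a b m hy
        rcases List.suffix_cons_iff.1 hxy with h3 | h3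
        · exact absurd (Subtype.ext h3) hne'
        · rcases List.suffix_cons_iff.1 h3 with h4 | h4
          · subst h4
            simp only [hφ, List.head_cons]
            refine ⟨he.1.ne', iff_of_true he.1.symm (Or.inr ⟨a, rfl⟩)⟩
          · cases x with
            | nil => exact absurd hx h0
            | cons e q =>
              have hem : e ∈ m := h4.subset (by simp)
              simp only [hφ, List.head_cons]
              refine ⟨(he.2 e hem).1, iff_of_false (fun hh => (he.2 e hem).2 hh.symm) ?_⟩
              have hle := h4.length_le
              rintro (⟨u, hu⟩ | ⟨u, hu⟩)
              · have := congrArg List.length hu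
                simp only [List.length_cons] at this hle
                omega
              · have := congrArg List.length hu
                simp only [List.length_cons] at this hle
                omega
    have hsuf := listGraph_onRootPath (NN v A) v hv h0 h1 h2 l
    have aux2 : ∀ x y, OnRootPath (listGraph (NN v A)) ⟨[v], hv⟩ l x →
        OnRootPath (listGraph (NN v A)) ⟨[v], hv⟩ l y → x ≠ y →
        φ x ≠ φ y ∧ (G.Adj (φ x) (φ y) ↔ (listGraph (NN v A)).Adj x y) := by
      intro x y hx hy hxy
      rcases List.suffix_or_suffix_of_suffix (hsuf x hx) (hsuf y hy) with h3 | h3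
      · exact aux x y h3 hxy
      · obtain ⟨h4, h5⟩ := aux y x h3 hxy.symm
        exact ⟨h4.symm, by rw [SimpleGraph.adj_comm, h5, SimpleGraph.adj_comm]⟩
    constructor
    · intro x hx y hy hxy
      by_contra hcon
      exact (aux2 x y hx hy hcon).1 hxy
    · intro x y hx hy
      by_cases hxy : x = y
      · subst hxy
        simp
      · exact (aux2 x y hx hy hxy).2

/-! ### Counting -/

open Classical in
lemma eCount_eq {V : Type*} (G : SimpleGraph V) (B A : Finset V) :
    eCount G B A = ∑ v ∈ B, (A.filter fun a => G.Adj v a).card := by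
  have : {p : V × V | p.1 ∈ B ∧ p.2 ∈ A ∧ G.Adj p.1 p.2} =
      (((B ×ˢ A).filter fun p => G.Adj p.1 p.2 : Finset (V × V)) : Set (V × V)) := by
    ext p
    simp [and_assoc]
  unfold eCount
  rw [this, Set.ncard_coe_finset, Finset.card_filter, Finset.sum_product]
  simp only [Finset.card_filter]

open Classical in
lemma bad_count {V : Type} [Fintype V] (G : SimpleGraph V) (c d D : ℝ) (t : ℕ)
    (hG : CTSparse G c t) (ht : 1 ≤ t) (hd : (t : ℝ) ≤ d) (hc0 : 0 < c) (hc2 : c < 1 / 2)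
    (hD : 4 / c * d ≤ D) : ∀ k (l : List V), l ≠ [] → PP G D k l →
    ((Finset.univ.filter fun v => ¬ PP G d k (l ++ [v])).card : ℝ) ≤ (4 / c) ^ k * t := by
  have ht' : (1 : ℝ) ≤ t := by exact_mod_cast ht
  have hc4 : 1 ≤ 4 / c := by rw [le_div_iff₀ hc0]; linarith
  intro k
  induction k with
  | zero =>
    intro l _ _
    simp [PP]
  | succ k ih =>
    rintro l hl ⟨A, hAD, hA⟩
    set B := Finset.univ.filter fun v => ¬ PP G d (k + 1) (l ++ [v]) with hB
    set K : ℝ := (4 / c) ^ k * t with hK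
    have hpow : (t : ℝ) ≤ (4 / c) ^ (k + 1) * t := by
      have := one_le_pow₀ hc4 (n := k + 1)
      nlinarith
    by_cases hBt : B.card < t
    · have : (B.card : ℝ) ≤ t := by exact_mod_cast hBt.le
      linarith
    have hdD : d ≤ D := by nlinarith
    have hAt : t ≤ A.card := by
      have : (t : ℝ) ≤ A.card := by linarith
      exact_mod_cast this
    have hsp := hG B A (not_lt.1 hBt) hAt
    rw [eCount_eq] at hsp
    push_cast at hsp
    -- each bad vertex
    have hv : ∀ v ∈ B, (A.card : ℝ) ≤ d + 1 + ((A.filter fun a => G.Adj v a).card : ℝ) +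
        ((A.filter fun a => ¬ PP G d k (a :: l ++ [v])).card : ℝ) := by
      intro v hvB
      have hvB : ¬ PP G d (k + 1) (l ++ [v]) := (Finset.mem_filter.1 hvB).2
      set F := A.filter fun a => a ≠ v ∧ ¬ G.Adj v a ∧ PP G d k (a :: l ++ [v]) with hF
      have hFd : (F.card : ℝ) ≤ d := by
        by_contra hcon
        apply hvB
        refine ⟨F, by linarith, ?_⟩
        intro a ha
        obtain ⟨ha1, ha2, ha3, ha4⟩ := Finset.mem_filter.1 ha
        exact ⟨ExtP_append G a v l hl (hA a ha1).1 ha2 (fun h => ha3 h.symm), ha4⟩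
      have hsub : A ⊆ ((F ∪ {v}) ∪ (A.filter fun a => G.Adj v a)) ∪
          (A.filter fun a => ¬ PP G d k (a :: l ++ [v])) := by
        intro a ha
        simp only [hF, Finset.mem_union, Finset.mem_filter, Finset.mem_singleton, ha, true_and]
        tauto
      have h3 : A.card ≤ F.card + 1 + (A.filter fun a => G.Adj v a).card +
          (A.filter fun a => ¬ PP G d k (a :: l ++ [v])).card := by
        refine (Finset.card_le_card hsub).trans ?_
        refine (Finset.card_union_le _ _).trans ?_
        gcongr
        refine (Finset.card_union_le _ _).trans ?_
        gcongr
        refine (Finset.card_union_le _ _).trans ?_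
        simp
      have h4 : (A.card : ℝ) ≤ F.card + 1 + (A.filter fun a => G.Adj v a).card +
          (A.filter fun a => ¬ PP G d k (a :: l ++ [v])).card := by exact_mod_cast h3
      linarith
    have hsum := Finset.sum_le_sum hv
    simp only [Finset.sum_add_distrib, Finset.sum_const, nsmul_eq_mul] at hsum
    have hdc : ∑ v ∈ B, ((A.filter fun a => ¬ PP G d k (a :: l ++ [v])).card : ℝ) ≤ A.card * K := by
      have h5 : ∑ v ∈ B, (A.filter fun a => ¬ PP G d k (a :: l ++ [v])).card =
          ∑ a ∈ A, (B.filter fun v => ¬ PP G d k (a :: l ++ [v])).card := by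
        simp only [Finset.card_filter]
        exact Finset.sum_comm
      have h6 : ∑ a ∈ A, ((B.filter fun v => ¬ PP G d k (a :: l ++ [v])).card : ℝ) ≤
          ∑ a ∈ A, K := by
        refine Finset.sum_le_sum fun a ha => ?_
        refine le_trans ?_ (ih (a :: l) (by simp) (hA a ha).2)
        exact_mod_cast Finset.card_le_card (Finset.filter_subset_filter _ (Finset.subset_univ B))
      rw [Finset.sum_const, nsmul_eq_mul] at h6
      refine le_trans (le_of_eq ?_) h6
      exact_mod_cast h5
    have hdA : d ≤ c / 4 * A.card := by
      have h7 : 4 / c * d ≤ A.card := hD.trans hAD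
      have h8 : c / 4 * (4 / c * d) = d := by field_simp
      have h9 := mul_le_mul_of_nonneg_left h7 (by positivity : 0 ≤ c / 4)
      linarith
    have hApos : (0 : ℝ) < A.card := by
      have : (t : ℝ) ≤ A.card := by exact_mod_cast hAt
      linarith
    have hB0 : (0 : ℝ) ≤ B.card := by positivity
    have h10 : (B.card : ℝ) * (c / 2 * A.card) ≤ K * A.card := by
      have : (B.card : ℝ) * (d + 1) ≤ B.card * (c / 2 * A.card) :=
        mul_le_mul_of_nonneg_left (by linarith) hB0
      nlinarith
    have h11 : (B.card : ℝ) * (c / 2) ≤ K := by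
      refine le_of_mul_le_mul_right ?_ hApos
      linarith
    have hK0 : 0 ≤ K := by positivity
    have h12 : (4 / c) ^ (k + 1) * t = 4 / c * K := by rw [hK]; ring
    rw [h12, div_mul_eq_mul_div, le_div_iff₀ hc0]
    nlinarith

open Classical in
lemma edge_count {V : Type} [Fintype V] (G : SimpleGraph V) (R : Set V) :
    G.edgeSet.ncard ≤ (G.induce Rᶜ).edgeSet.ncard +
      ∑ u ∈ Finset.univ.filter (fun u => u ∈ R), (Finset.univ.filter fun v => G.Adj u v).card := by
  have hsub : G.edgeSet ⊆ (Sym2.map Subtype.val '' (G.induce Rᶜ).edgeSet) ∪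
      ((fun p : V × V => s(p.1, p.2)) '' {p : V × V | p.1 ∈ Finset.univ.filter (fun u => u ∈ R) ∧
        p.2 ∈ Finset.univ ∧ G.Adj p.1 p.2}) := by
    intro e
    induction e using Sym2.ind with
    | _ x y =>
      intro hxy
      rw [SimpleGraph.mem_edgeSet] at hxy
      by_cases hx : x ∈ R
      · exact Or.inr ⟨(x, y), by simp [hx, hxy], rfl⟩
      by_cases hy : y ∈ R
      · exact Or.inr ⟨(y, x), by simp [hy, hxy.symm], Sym2.eq_swap⟩
      · exact Or.inl ⟨s(⟨x, hx⟩, ⟨y, hy⟩), hxy, rfl⟩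
  refine (Set.ncard_le_ncard hsub (Set.toFinite _)).trans ?_
  refine (Set.ncard_union_le _ _).trans ?_
  refine add_le_add (Set.ncard_image_le (Set.toFinite _)) ?_
  refine (Set.ncard_image_le (Set.toFinite _)).trans ?_
  exact (eCount_eq G _ _).le

/-- for integers `h ≥ 1`, `t ≥ 1`, a real `d ≥ t` and
`c ∈ (0,1/2)`, every `(c,t)`-sparse graph `G` either has an induced subgraph
`J` with `|E(J)|/|V(J)| ≥ |E(G)|/|V(G)| - 2(4/c)^(h+1)·d` containing no
`((4/c)^(h+1)·d, h)`-skeleton, or contains a `(d,h+1)`-skeleton. -/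
theorem stmt13 (h t : ℕ) (hh : 1 ≤ h) (ht : 1 ≤ t) (d : ℝ) (hd : (t : ℝ) ≤ d)
    (c : ℝ) (hc0 : 0 < c) (hc2 : c < 1 / 2)
    (V : Type) [Fintype V] (G : SimpleGraph V) (hG : CTSparse G c t) :
    (∃ S : Set V,
      edgeVertexRatio G - 2 * (4 / c) ^ (h + 1) * d ≤ edgeVertexRatio (G.induce S) ∧
      ¬ HasSkeleton (G.induce S) ((4 / c) ^ (h + 1) * d) h) ∨
    HasSkeleton G d (h + 1) := by
  classical
  by_contra hcon
  push Not at hcon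
  obtain ⟨hS, hno⟩ := hcon
  set D : ℝ := (4 / c) ^ (h + 1) * d with hDdef
  have ht' : (1 : ℝ) ≤ t := by exact_mod_cast ht
  have hd1 : 1 ≤ d := ht'.trans hd
  have hc4 : 1 ≤ 4 / c := by rw [le_div_iff₀ hc0]; linarith
  have hp1 : 1 ≤ (4 / c) ^ h := one_le_pow₀ hc4
  have hD1 : 4 / c * d ≤ D := by
    rw [hDdef, pow_succ]
    have : 0 ≤ 4 / c * d := by positivity
    nlinarith
  have hDh : (4 / c) ^ h * t ≤ D := by
    have h1 : (4 / c) ^ h * t ≤ (4 / c) ^ h * d := by gcongr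
    have h2 : (4 / c) ^ h * d ≤ (4 / c) ^ (h + 1) * d := by
      gcongr
      omega
    linarith
  have hdD : d < D := by
    have : 1 < 4 / c := by rw [lt_div_iff₀ hc0]; linarith
    nlinarith
  have hS' : ∀ S : Set V, ¬ HasSkeleton (G.induce S) D h →
      edgeVertexRatio (G.induce S) < edgeVertexRatio G - 2 * D := by
    intro S hSn
    by_contra hlt
    refine hSn (hS S ?_)
    rw [hDdef] at hlt
    linarith
  have hr : 0 < edgeVertexRatio G - 2 * D := by
    refine lt_of_le_of_lt ?_ (hS' ∅ ?_)
    · unfold edgeVertexRatio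
      positivity
    · intro hsk
      obtain ⟨w, -⟩ := PP_of_hasSkeleton _ _ _ hsk
      exact w.2
  set R : Set V := {u | PP G D h [u]} with hR
  have hRc := hS' Rᶜ (by
    intro hsk
    obtain ⟨w, hw⟩ := PP_of_hasSkeleton _ _ _ hsk
    exact w.2 (PP_map G _ _ _ _ hw))
  set n : ℝ := (Nat.card V : ℝ) with hn
  have hnpos : 0 < n := by
    rcases (Nat.cast_nonneg (α := ℝ) (Nat.card V)).lt_or_eq with h1 | h1
    · exact h1
    · exfalso
      unfold edgeVertexRatio at hr
      rw [← h1, div_zero] at hr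
      linarith
  have hE : ((G.induce Rᶜ).edgeSet.ncard : ℝ) ≤ G.edgeSet.ncard - 2 * D * n := by
    have h1 : ((G.induce Rᶜ).edgeSet.ncard : ℝ) ≤
        (edgeVertexRatio G - 2 * D) * (Nat.card (Rᶜ : Set V) : ℝ) := by
      rcases Nat.eq_zero_or_pos (Nat.card (Rᶜ : Set V)) with h0 | h0
      · have hem : IsEmpty (Rᶜ : Set V) := (Finite.card_eq_zero_iff).1 h0
        have : (G.induce Rᶜ).edgeSet = ∅ := by
          ext e
          induction e using Sym2.ind with
          | _ x y => exact hem.elim x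
        rw [this, h0]
        simp
      · have h0' : (0 : ℝ) < (Nat.card (Rᶜ : Set V) : ℝ) := by exact_mod_cast h0
        have := hRc.le
        unfold edgeVertexRatio at this ⊢
        rwa [div_le_iff₀ h0'] at this
    have h2 : (Nat.card (Rᶜ : Set V) : ℝ) ≤ n := by
      rw [hn]
      exact_mod_cast Finite.card_subtype_le _
    have h3 : (edgeVertexRatio G - 2 * D) * n = G.edgeSet.ncard - 2 * D * n := by
      unfold edgeVertexRatio
      rw [← hn]
      field_simp
    have := mul_le_mul_of_nonneg_left h2 hr.le
    linarith
  have hec := edge_count G R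
  have hec' : (G.edgeSet.ncard : ℝ) ≤ (G.induce Rᶜ).edgeSet.ncard +
      ∑ u ∈ Finset.univ.filter (fun u => u ∈ R),
        ((Finset.univ.filter fun v => G.Adj u v).card : ℝ) := by exact_mod_cast hec
  -- split each degree into good and bad neighbours
  have hbad : ∀ u ∈ Finset.univ.filter (fun u => u ∈ R),
      ((Finset.univ.filter fun v => G.Adj u v).card : ℝ) ≤
        ((Finset.univ.filter fun v => G.Adj u v ∧ PP G d h [u, v]).card : ℝ) + D := by
    intro u hu
    have huR : PP G D h [u] := (Finset.mem_filter.1 hu).2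
    have h1 := bad_count G c d D t hG ht hd hc0 hc2 hD1 h [u] (by simp) huR
    have h2 : (Finset.univ.filter fun v => G.Adj u v).card ≤
        (Finset.univ.filter fun v => G.Adj u v ∧ PP G d h [u, v]).card +
        (Finset.univ.filter fun v => ¬ PP G d h ([u] ++ [v])).card := by
      refine (Finset.card_le_card ?_).trans (Finset.card_union_le _ _)
      intro v hv
      simp only [Finset.mem_union, Finset.mem_filter, Finset.mem_univ, true_and,
        List.singleton_append] at hv ⊢
      tauto
    have h3 : ((Finset.univ.filter fun v => G.Adj u v).card : ℝ) ≤
        (Finset.univ.filter fun v => G.Adj u v ∧ PP G d h [u, v]).card +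
        (Finset.univ.filter fun v => ¬ PP G d h ([u] ++ [v])).card := by exact_mod_cast h2
    linarith
  have hsum := Finset.sum_le_sum hbad
  rw [Finset.sum_add_distrib, Finset.sum_const, nsmul_eq_mul] at hsum
  have hRn : ((Finset.univ.filter (fun u => u ∈ R)).card : ℝ) ≤ n := by
    rw [hn, Nat.card_eq_fintype_card]
    exact_mod_cast Finset.card_le_univ _
  have hgood : ∑ u ∈ Finset.univ.filter (fun u => u ∈ R),
      ((Finset.univ.filter fun v => G.Adj u v ∧ PP G d h [u, v]).card : ℝ) ≤ n * d := by
    have h1 : ∑ u ∈ Finset.univ.filter (fun u => u ∈ R),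
        (Finset.univ.filter fun v => G.Adj u v ∧ PP G d h [u, v]).card =
        ∑ v : V, ((Finset.univ.filter (fun u => u ∈ R)).filter
          fun u => G.Adj u v ∧ PP G d h [u, v]).card := by
      simp only [Finset.card_filter _ Finset.univ,
        Finset.card_filter _ (Finset.univ.filter (fun u => u ∈ R))]
      exact Finset.sum_comm
    have h2 : ∑ v : V, (((Finset.univ.filter (fun u => u ∈ R)).filter
          fun u => G.Adj u v ∧ PP G d h [u, v]).card : ℝ) ≤ ∑ v : V, d := by
      refine Finset.sum_le_sum fun v _ => ?_
      by_contra hlt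
      apply hno
      refine hasSkeleton_of_PP G d (by linarith) (h + 1) v ⟨_, (not_le.1 hlt).le, ?_⟩
      intro a ha
      have ha' := (Finset.mem_filter.1 ha).2
      exact ⟨⟨ha'.1, by simp⟩, ha'.2⟩
    rw [Finset.sum_const, nsmul_eq_mul, Finset.card_univ, ← Nat.card_eq_fintype_card, ← hn] at h2
    refine le_trans (le_of_eq ?_) h2
    exact_mod_cast h1
  have hfin : ((Finset.univ.filter (fun u => u ∈ R)).card : ℝ) * D ≤ n * D :=
    mul_le_mul_of_nonneg_right hRn (by linarith)
  have hlast : n * d < n * D := mul_lt_mul_of_pos_left hdD hnpos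
  linarith
end

section
/- Let (F,ρ) be a rooted tree of depth h ≥ 0, let c ∈ (0, 1/2) be real, and let t ≥ 1 be an integer. Then every (c,t)-sparse graph G that contains a ((4/c)^(3h·|V(F)|)·t, h)-skeleton contains an induced subgraph isomorphic to F. -/
open SimpleGraph

lemma sk_parent_unique {V : Type*} {T : SimpleGraph V} (hT : T.IsTree) {r x x' y : V}
    (h1 : IsChild T r x y) (h2 : IsChild T r x' y) : x = x' := by
  obtain ⟨p, hp⟩ := hT.connected.exists_walk_length_eq_dist r x
  obtain ⟨p', hp'⟩ := hT.connected.exists_walk_length_eq_dist r x'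
  have a1 : (p.concat h1.1).IsPath := by
    apply Walk.isPath_of_length_eq_dist
    rw [Walk.length_concat, hp, h1.2]
  have a2 : (p'.concat h2.1).IsPath := by
    apply Walk.isPath_of_length_eq_dist
    rw [Walk.length_concat, hp', h2.2]
  have := congrArg Subtype.val (hT.isAcyclic.path_unique ⟨_, a1⟩ ⟨_, a2⟩)
  simp only at this
  exact (Walk.concat_inj this).1

lemma sk_parent_exists {V : Type*} {T : SimpleGraph V} (hT : T.IsTree) {r y : V}
    (hy : y ≠ r) : ∃ x, IsChild T r x y := by
  obtain ⟨p, hp⟩ := hT.connected.exists_walk_length_eq_dist y r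
  cases p with
  | nil => exact absurd rfl hy
  | @cons _ x _ hadj p' =>
    refine ⟨x, hadj.symm, ?_⟩
    have h1 := dist_le p'
    rw [Walk.length_cons] at hp
    rw [dist_comm (u := y)] at hp
    rw [dist_comm (u := x)] at h1
    rcases hT.dist_eq_dist_add_one_of_adj r hadj with h | h <;> omega

/-- Ancestor relation. -/
def skAnc {V : Type*} (T : SimpleGraph V) (r : V) : V → V → Prop :=
  Relation.ReflTransGen (IsChild T r)

lemma sk_anc_dist {V : Type*} {T : SimpleGraph V} (hT : T.IsTree) {r x y : V}
    (h : skAnc T r x y) : T.dist r x + T.dist x y = T.dist r y := by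
  apply le_antisymm _ hT.connected.dist_triangle
  induction h with
  | refl => simp
  | @tail b c _ hbc ih =>
    have h1 : T.dist x c ≤ T.dist x b + T.dist b c := hT.connected.dist_triangle
    have h2 : T.dist b c = 1 := dist_eq_one_iff_adj.mpr hbc.1
    have h3 := hbc.2
    omega

lemma sk_anc_trans {V : Type*} {T : SimpleGraph V} {r x y z : V}
    (h : skAnc T r x y) (h' : skAnc T r y z) : skAnc T r x z :=
  Relation.ReflTransGen.trans h h'

lemma sk_anc_eq {V : Type*} {T : SimpleGraph V} (hT : T.IsTree) {r x y : V}
    (h : skAnc T r x y) (hd : T.dist r x = T.dist r y) : x = y := by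
  have := sk_anc_dist hT h
  exact hT.connected.dist_eq_zero_iff.mp (by omega)

lemma sk_anc_child {V : Type*} {T : SimpleGraph V} (hT : T.IsTree) {r x y z : V}
    (h : IsChild T r x y) (ha : skAnc T r z y) : z = y ∨ skAnc T r z x := by
  rcases Relation.ReflTransGen.cases_tail ha with h1 | ⟨b, h1, h2⟩
  · exact Or.inl h1.symm
  · right
    rw [sk_parent_unique hT h h2]
    exact h1

lemma sk_dist_le {V : Type*} [Finite V] (T : SimpleGraph V) (r : V) (x : V) :
    T.dist r x ≤ rootDepth T r :=
  le_csSup (Set.finite_range _).bddAbove ⟨x, rfl⟩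

lemma sk_leaf {V : Type*} [Finite V] {T : SimpleGraph V} {r : V} {d : ℝ} {h : ℕ}
    (hw : IsWide T r d h) (hd : 0 < d) (hh : 1 ≤ h) (b : V) :
    ∃ l, IsTreeLeaf T r l ∧ skAnc T r b l := by
  obtain ⟨l, hl, hmax⟩ := Set.exists_max_image {l | skAnc T r b l} (T.dist r) (Set.toFinite _)
    ⟨b, Relation.ReflTransGen.refl⟩
  have hnc : ∀ v, ¬ IsChild T r l v := by
    intro v hv
    have := hmax v (sk_anc_trans hl (Relation.ReflTransGen.single hv))
    have := hv.2
    omega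
  refine ⟨l, ⟨?_, hnc⟩, hl⟩
  rintro rfl
  have := hw.2 l (by rw [dist_self]; omega)
  have he : {v | IsChild T l l v} = ∅ := by
    ext v; simpa using hnc v
  rw [he] at this
  simp at this
  linarith

lemma sk_path {V W : Type*} [Finite V] {T : SimpleGraph V} (hT : T.IsTree) {r : V} {d : ℝ} {h : ℕ}
    (hw : IsWide T r d h) (hd : 0 < d) (hh : 1 ≤ h) {G : SimpleGraph W} {φ : T →g G}
    (hs : IsSkeleton T r G φ) {a b : V} (hab : skAnc T r a b) :
    (φ a = φ b → a = b) ∧ (G.Adj (φ a) (φ b) ↔ T.Adj a b) := by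
  obtain ⟨l, hl, hbl⟩ := sk_leaf hw hd hh b
  have h1 : OnRootPath T r l a := sk_anc_dist hT (sk_anc_trans hab hbl)
  have h2 : OnRootPath T r l b := sk_anc_dist hT hbl
  obtain ⟨h3, h4⟩ := hs.2 l hl
  exact ⟨fun h => h3 h1 h2 h, h4 a b h1 h2⟩

/-- Hereditary width. -/
def Wd {α : Type*} (C : α → α → Prop) (P : α → Prop) (d : ℝ) : ℕ → α → Prop
  | 0, _ => True
  | j + 1, u => d ≤ (Set.ncard {w | C u w ∧ P w ∧ Wd C P d j w} : ℝ)

lemma Wd_mono {α : Type*} [Finite α] {C : α → α → Prop} {P P' : α → Prop} {d d' : ℝ}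
    (hP : ∀ w, P w → P' w) (hd : d' ≤ d) : ∀ (j : ℕ) (u : α), Wd C P d j u → Wd C P' d' j u
  | 0, _, _ => trivial
  | j + 1, u, h => by
    unfold Wd at h ⊢
    refine hd.trans (h.trans ?_)
    norm_cast
    apply Set.ncard_le_ncard _ (Set.toFinite _)
    intro w hw
    exact ⟨hw.1, hP _ hw.2.1, Wd_mono hP hd j w hw.2.2⟩

lemma Wd_base {V : Type*} {T : SimpleGraph V} {r : V} {d : ℝ} {h : ℕ}
    (hw : IsWide T r d h) : ∀ (j : ℕ) (u : V), T.dist r u + j = h →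
      Wd (IsChild T r) (fun _ => True) d j u
  | 0, _, _ => trivial
  | j + 1, u, hu => by
    unfold Wd
    have := hw.2 u (by omega)
    have he : {w | IsChild T r u w ∧ True ∧ Wd (IsChild T r) (fun _ => True) d j w}
        = {w | IsChild T r u w} := by
      ext w
      simp only [Set.mem_ofPred_eq, true_and, and_iff_left_iff_imp]
      intro hc
      exact Wd_base hw j w (by have := hc.2; omega)
    rw [he]; exact this

open Classical in
lemma sk_trim {α V : Type*} [Fintype α] [Fintype V] {G : SimpleGraph V} {c : ℝ} {t : ℕ}
    (hc0 : 0 < c) (hc2 : c < 1 / 2) (ht : 1 ≤ t) (hG : CTSparse G c t)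
    (C : α → α → Prop) (φ : α → V) (hinj : ∀ u, Set.InjOn φ {w | C u w})
    (P : α → Prop) (d : ℝ) (hdt : (t : ℝ) ≤ d) (hdc : 2 / c ≤ d) (j : ℕ) :
    ∀ u : α, Wd C P d j u →
    ((Finset.univ.filter (fun v : V =>
      ¬ Wd C (fun w => P w ∧ ¬ G.Adj (φ w) v ∧ φ w ≠ v) (d / (4 / c)) j u)).card : ℝ)
      ≤ ((4 / c) ^ j - 1) * t := by
  induction j with
  | zero => intro u _; simp [Wd]
  | succ j ih =>
    intro u hu
    set q : ℝ := 4 / c with hq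
    have hq8 : 8 ≤ q := by rw [hq, le_div_iff₀ hc0]; linarith
    have hqc : q * c = 4 := by rw [hq]; field_simp
    set X := Finset.univ.filter (fun v : V =>
      ¬ Wd C (fun w => P w ∧ ¬ G.Adj (φ w) v ∧ φ w ≠ v) (d / q) (j + 1) u) with hX
    set A : Finset α := Finset.univ.filter (fun w => C u w ∧ P w ∧ Wd C P d j w) with hA
    have hAd : d ≤ (A.card : ℝ) := by
      unfold Wd at hu
      rw [Set.ncard_eq_toFinset_card'] at hu
      convert hu using 3
      ext w; simp [hA]
    have hAi : Set.InjOn φ (A : Set α) := by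
      intro a ha b hb hab
      simp only [hA, Finset.coe_filter, Finset.mem_univ, true_and, Set.mem_ofPred_eq] at ha hb
      exact hinj u ha.1 hb.1 hab
    let b : V → α → Prop := fun v w =>
      ¬ Wd C (fun w => P w ∧ ¬ G.Adj (φ w) v ∧ φ w ≠ v) (d / q) j w
    set X1 := X.filter (fun v => (1 - c) * A.card < ((A.filter (fun w => G.Adj (φ w) v)).card : ℝ))
      with hX1
    set X2 := X.filter (fun v => ¬ (1 - c) * A.card < ((A.filter (fun w => G.Adj (φ w) v)).card : ℝ))
      with hX2
    have hsplit : X1.card + X2.card = X.card := Finset.card_filter_add_card_filter_not _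
    set N : ℝ := (A.card : ℝ) with hN
    have hNc : 2 ≤ c * N := by
      have : 2 / c ≤ N := hdc.trans hAd
      rw [div_le_iff₀ hc0] at this; linarith
    have hNpos : 0 < N := by
      by_contra hcon
      push Not at hcon
      nlinarith
    have h1 : X1.card < t := by
      by_contra hcon
      push Not at hcon
      have hcardA : (A.image φ).card = A.card := Finset.card_image_of_injOn hAi
      have hs := hG X1 (A.image φ) hcon (by
        rw [hcardA]; have := hdt.trans hAd; rw [hN] at this; exact_mod_cast this)
      rw [hcardA] at hs
      have he : eCount G X1 (A.image φ) = ∑ v ∈ X1, (A.filter (fun w => G.Adj (φ w) v)).card := by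
        unfold eCount
        rw [← Finset.card_sigma, Set.ncard_eq_toFinset_card']
        symm
        apply Finset.card_bij (fun p _ => (p.1, φ p.2))
        · rintro ⟨v, w⟩ hp
          simp only [Finset.mem_sigma, Finset.mem_filter] at hp
          simp only [Set.mem_toFinset, Set.mem_ofPred_eq]
          exact ⟨hp.1, Finset.mem_image_of_mem _ hp.2.1, hp.2.2.symm⟩
        · rintro ⟨v, w⟩ hp ⟨v', w'⟩ hp' heq
          simp only [Finset.mem_sigma, Finset.mem_filter] at hp hp'
          simp only [Prod.mk.injEq] at heq
          obtain ⟨rfl, h2⟩ := heq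
          rw [hAi hp.2.1 hp'.2.1 h2]
        · rintro ⟨v, y⟩ hp
          simp only [Set.mem_toFinset, Set.mem_ofPred_eq, Finset.mem_image] at hp
          obtain ⟨hv, ⟨w, hw, rfl⟩, hadj⟩ := hp
          refine ⟨⟨v, w⟩, ?_, rfl⟩
          simp only [Finset.mem_sigma, Finset.mem_filter]
          exact ⟨hv, hw, hadj.symm⟩
      rw [he] at hs
      push_cast at hs
      have hlt : ∑ v ∈ X1, ((1 - c) * N) <
          ∑ v ∈ X1, ((A.filter (fun w => G.Adj (φ w) v)).card : ℝ) := by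
        apply Finset.sum_lt_sum_of_nonempty
        · rw [← Finset.card_pos]; omega
        · intro v hv
          exact (Finset.mem_filter.mp hv).2
      rw [Finset.sum_const, nsmul_eq_mul] at hlt
      nlinarith
    have hb : ∀ v ∈ X2, N / q ≤ ((A.filter (b v)).card : ℝ) := by
      intro v hv
      obtain ⟨hvX, hv2⟩ := Finset.mem_filter.mp hv
      have hv1 := (Finset.mem_filter.mp hvX).2
      unfold Wd at hv1
      push Not at hv1 hv2
      set D := A.filter (fun w => (¬ G.Adj (φ w) v ∧ φ w ≠ v) ∧ ¬ b v w)
      have hD : (D.card : ℝ) < d / q := by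
        refine lt_of_le_of_lt ?_ hv1
        rw [← Set.ncard_coe_finset]
        apply Nat.cast_le.mpr
        apply Set.ncard_le_ncard _ (Set.toFinite _)
        intro w hw
        have hw := Finset.mem_filter.mp (Finset.mem_coe.mp hw)
        have hwA := (Finset.mem_filter.mp hw.1).2
        exact ⟨hwA.1, ⟨hwA.2.1, hw.2.1⟩, not_not.mp hw.2.2⟩
      have hE : (A.filter (fun w => φ w = v)).card ≤ 1 := by
        rw [Finset.card_le_one]
        intro x hx y hy
        have hx := Finset.mem_filter.mp hx
        have hy := Finset.mem_filter.mp hy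
        exact hAi hx.1 hy.1 (hx.2.trans hy.2.symm)
      have hcov : A ⊆ A.filter (fun w => G.Adj (φ w) v) ∪ A.filter (fun w => φ w = v) ∪ D
          ∪ A.filter (b v) := by
        intro w hw
        simp only [D, Finset.mem_union, Finset.mem_filter, hw, true_and]
        tauto
      have hcard := Finset.card_le_card hcov
      have e1 := Finset.card_union_le (A.filter (fun w => G.Adj (φ w) v) ∪ A.filter (fun w => φ w = v) ∪ D)
        (A.filter (b v))
      have e2 := Finset.card_union_le (A.filter (fun w => G.Adj (φ w) v) ∪ A.filter (fun w => φ w = v)) D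
      have e3 := Finset.card_union_le (A.filter (fun w => G.Adj (φ w) v)) (A.filter (fun w => φ w = v))
      have e4 : A.card ≤ (A.filter (fun w => G.Adj (φ w) v)).card + 1 + D.card
          + (A.filter (b v)).card := by omega
      have e5 : N ≤ ((A.filter (fun w => G.Adj (φ w) v)).card : ℝ) + 1 + D.card
          + (A.filter (b v)).card := by rw [hN]; exact_mod_cast e4
      have e6 : d / q ≤ N / q := by gcongr
      have e7 : N / q = c * N / 4 := by rw [hq]; field_simp
      linarith
    have h2 : (X2.card : ℝ) ≤ q * ((q ^ j - 1) * t) := by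
      have hdc := Finset.sum_card_bipartiteAbove_eq_sum_card_bipartiteBelow (s := X2) (t := A) b
      have l1 : (X2.card : ℝ) * (N / q) ≤ ∑ v ∈ X2, ((A.filter (b v)).card : ℝ) := by
        rw [← nsmul_eq_mul]
        exact Finset.card_nsmul_le_sum _ _ _ hb
      have l2 : ∑ w ∈ A, ((X2.filter (fun v => b v w)).card : ℝ) ≤ N * ((q ^ j - 1) * t) := by
        rw [hN, ← nsmul_eq_mul]
        apply Finset.sum_le_card_nsmul
        intro w hw
        refine le_trans ?_ (ih w (Finset.mem_filter.mp hw).2.2.2)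
        norm_cast
        apply Finset.card_le_card
        intro v hv
        have := (Finset.mem_filter.mp hv).2
        exact Finset.mem_filter.mpr ⟨Finset.mem_univ _, this⟩
      have l3 : ∑ v ∈ X2, ((A.filter (b v)).card : ℝ)
          = ∑ w ∈ A, ((X2.filter (fun v => b v w)).card : ℝ) := by
        exact_mod_cast hdc
      have l4 : (X2.card : ℝ) * (N / q) ≤ N * ((q ^ j - 1) * t) := by linarith
      have l5 : (X2.card : ℝ) * (N / q) = N * (X2.card / q) := by ring
      rw [l5] at l4
      have l6 := le_of_mul_le_mul_left l4 hNpos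
      rw [div_le_iff₀ (by linarith)] at l6
      linarith
    have h1' : (X1.card : ℝ) ≤ t := by exact_mod_cast h1.le
    have hs' : (X1.card : ℝ) + X2.card = X.card := by exact_mod_cast hsplit
    have ht' : (1 : ℝ) ≤ t := by exact_mod_cast ht
    rw [← hs', pow_succ]
    nlinarith

open Classical in
lemma sk_step {U V W : Type*} [Fintype U] [Fintype V] [Fintype W]
    {F : SimpleGraph U} (hF : F.IsTree) {ρ : U} {h : ℕ} (hdepth : rootDepth F ρ = h)
    {c : ℝ} (hc0 : 0 < c) (hc2 : c < 1 / 2) {t : ℕ} (ht : 1 ≤ t)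
    {G : SimpleGraph V} (hG : CTSparse G c t)
    {T : SimpleGraph W} {r : W} {φ : T →g G} (hinj : ∀ v : W, Set.InjOn φ (T.neighborSet v))
    (S : Finset U) (τ : U → W) (d : ℝ)
    (hdt : (t : ℝ) ≤ d) (hdc : 2 / c ≤ d) (hdS : (S.card : ℝ) * ((4 / c) ^ h * t) < d)
    (hρ : ρ ∈ S) (hcl : ∀ x y, IsChild F ρ x y → y ∈ S → x ∈ S)
    (hht : ∀ x ∈ S, T.dist r (τ x) = F.dist ρ x)
    (hch : ∀ x ∈ S, ∀ y ∈ S, IsChild F ρ x y → IsChild T r (τ x) (τ y))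
    (hna : ∀ x ∈ S, ∀ y ∈ S, ¬ skAnc F ρ x y → ¬ skAnc F ρ y x →
      ¬ G.Adj (φ (τ x)) (φ (τ y)) ∧ φ (τ x) ≠ φ (τ y))
    (hwd : ∀ x ∈ S, Wd (IsChild T r)
      (fun w => ∀ z ∈ S, ¬ skAnc F ρ z x → ¬ G.Adj (φ w) (φ (τ z)) ∧ φ w ≠ φ (τ z))
      d (h - F.dist ρ x) (τ x))
    (hne : S ≠ Finset.univ) :
    ∃ (S' : Finset U) (τ : U → W), S'.card = S.card + 1 ∧ ρ ∈ S' ∧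
    (∀ x y, IsChild F ρ x y → y ∈ S' → x ∈ S') ∧
    (∀ x ∈ S', T.dist r (τ x) = F.dist ρ x) ∧
    (∀ x ∈ S', ∀ y ∈ S', IsChild F ρ x y → IsChild T r (τ x) (τ y)) ∧
    (∀ x ∈ S', ∀ y ∈ S', ¬ skAnc F ρ x y → ¬ skAnc F ρ y x →
      ¬ G.Adj (φ (τ x)) (φ (τ y)) ∧ φ (τ x) ≠ φ (τ y)) ∧
    (∀ x ∈ S', Wd (IsChild T r)
      (fun w => ∀ z ∈ S', ¬ skAnc F ρ z x → ¬ G.Adj (φ w) (φ (τ z)) ∧ φ w ≠ φ (τ z))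
      (d / (4 / c)) (h - F.dist ρ x) (τ x)) := by
  have hq8 : 8 ≤ 4 / c := by rw [le_div_iff₀ hc0]; linarith
  have ht' : (1 : ℝ) ≤ t := by exact_mod_cast ht
  -- choose the new vertex
  obtain ⟨y, hy, hmin⟩ := Finset.exists_min_image (Finset.univ \ S) (F.dist ρ) (by
    rw [Finset.sdiff_nonempty]
    intro hs
    exact hne (Finset.univ_subset_iff.mp hs))
  have hyS : y ∉ S := (Finset.mem_sdiff.mp hy).2
  obtain ⟨x, hxy⟩ := sk_parent_exists hF (r := ρ) (y := y) (by rintro rfl; exact hyS hρ)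
  have hxS : x ∈ S := by
    by_contra hx
    have := hmin x (by simp [hx])
    have := hxy.2
    omega
  have hyh := sk_dist_le F ρ y
  rw [hdepth] at hyh
  obtain ⟨j, hj⟩ : ∃ j, h - F.dist ρ x = j + 1 := ⟨h - F.dist ρ x - 1, by have := hxy.2; omega⟩
  have hjy : h - F.dist ρ y = j := by have := hxy.2; omega
  -- closure under ancestors
  have hancS : ∀ a b, skAnc F ρ a b → b ∈ S → a ∈ S := by
    intro a b hab hb
    induction hab with
    | refl => exact hb
    | tail _ h2 ih => exact ih (hcl _ _ h2 hb)
  have hy_na : ∀ z ∈ S, ¬ skAnc F ρ y z := fun z hz ha => hyS (hancS _ _ ha hz)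
  -- choose the image
  set P : U → W → Prop := fun x w =>
    ∀ z ∈ S, ¬ skAnc F ρ z x → ¬ G.Adj (φ w) (φ (τ z)) ∧ φ w ≠ φ (τ z) with hP
  let A : Finset W := Finset.univ.filter
    (fun w => IsChild T r (τ x) w ∧ P x w ∧ Wd (IsChild T r) (P x) d j w)
  have hA : d ≤ (A.card : ℝ) := by
    have := hwd x hxS
    rw [hj] at this
    unfold Wd at this
    rw [Set.ncard_eq_toFinset_card'] at this
    convert this using 3
    ext w; simp [A, hP]
  let B : U → Finset V := fun z => Finset.univ.filter (fun v : V =>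
      ¬ Wd (IsChild T r) (fun w => P z w ∧ ¬ G.Adj (φ w) v ∧ φ w ≠ v) (d / (4 / c))
        (h - F.dist ρ z) (τ z))
  have hB : ∀ z ∈ S, ((B z).card : ℝ) ≤ (4 / c) ^ h * t := by
    intro z hz
    refine (sk_trim hc0 hc2 ht hG (IsChild T r) φ
      (fun u => (hinj u).mono (fun w hw => hw.1)) (P z) d hdt hdc _ _ (hwd z hz)).trans ?_
    have : (4 / c) ^ (h - F.dist ρ z) ≤ (4 / c) ^ h :=
      pow_le_pow_right₀ (by linarith) (Nat.sub_le _ _)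
    nlinarith
  obtain ⟨w, hwA, hwB⟩ : ∃ w ∈ A, ∀ z ∈ S, φ w ∉ B z := by
    by_contra hcon
    push Not at hcon
    have hsub : A.image φ ⊆ S.biUnion B := by
      intro v hv
      obtain ⟨w, hw, rfl⟩ := Finset.mem_image.mp hv
      obtain ⟨z, hz, hzB⟩ := hcon w hw
      exact Finset.mem_biUnion.mpr ⟨z, hz, hzB⟩
    have hcardA : (A.image φ).card = A.card := by
      apply Finset.card_image_of_injOn
      intro a ha b hb hab
      have ha := (Finset.mem_filter.mp (Finset.mem_coe.mp ha)).2
      have hb := (Finset.mem_filter.mp (Finset.mem_coe.mp hb)).2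
      exact hinj (τ x) ha.1.1 hb.1.1 hab
    have h1 := (Finset.card_le_card hsub).trans Finset.card_biUnion_le
    rw [hcardA] at h1
    have h2 : (A.card : ℝ) ≤ ∑ z ∈ S, ((B z).card : ℝ) := by exact_mod_cast h1
    have h3 := Finset.sum_le_card_nsmul S (fun z => ((B z).card : ℝ)) _ hB
    rw [nsmul_eq_mul] at h3
    linarith
  obtain ⟨hwc, hwP, hwW⟩ := (Finset.mem_filter.mp hwA).2
  set τ' : U → W := Function.update τ y w with hτ'
  have hτy : τ' y = w := by simp [hτ']
  have hτz : ∀ z ∈ S, τ' z = τ z := by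
    intro z hz
    rw [hτ', Function.update_of_ne]
    rintro rfl; exact hyS hz
  have hxa : skAnc F ρ x y := Relation.ReflTransGen.single hxy
  have hyz : ∀ z ∈ S, ¬ skAnc F ρ z y → ¬ G.Adj (φ w) (φ (τ z)) ∧ φ w ≠ φ (τ z) := by
    intro z hz hzy
    exact hwP z hz (fun ha => hzy (sk_anc_trans ha hxa))
  refine ⟨insert y S, τ', Finset.card_insert_of_notMem hyS, Finset.mem_insert_of_mem hρ,
    ?_, ?_, ?_, ?_, ?_⟩
  · intro a b hab hb
    rcases Finset.mem_insert.mp hb with rfl | hb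
    · rw [sk_parent_unique hF hab hxy]; exact Finset.mem_insert_of_mem hxS
    · exact Finset.mem_insert_of_mem (hcl a b hab hb)
  · intro a ha
    rcases Finset.mem_insert.mp ha with rfl | ha
    · rw [hτy, hwc.2, hxy.2, hht x hxS]
    · rw [hτz a ha, hht a ha]
  · intro a ha b hb hab
    rcases Finset.mem_insert.mp hb with rfl | hb
    · rw [sk_parent_unique hF hab hxy, hτy, hτz x hxS]; exact hwc
    · have ha := hcl a b hab hb
      rw [hτz a ha, hτz b hb]; exact hch a ha b hb hab
  · intro a ha b hb hab hba
    rcases Finset.mem_insert.mp ha with rfl | ha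
    · rcases Finset.mem_insert.mp hb with rfl | hb
      · exact absurd Relation.ReflTransGen.refl hab
      · rw [hτy, hτz b hb]; exact hyz b hb hba
    · rcases Finset.mem_insert.mp hb with hby | hb
      · rw [hby] at hab ⊢
        rw [hτy, hτz a ha]
        obtain ⟨h1, h2⟩ := hyz a ha hab
        exact ⟨fun h => h1 h.symm, fun h => h2 h.symm⟩
      · rw [hτz a ha, hτz b hb]; exact hna a ha b hb hab hba
  · intro a ha
    rcases Finset.mem_insert.mp ha with rfl | ha
    · rw [hτy, hjy]
      refine Wd_mono ?_ (div_le_self (by linarith) (by linarith)) j w hwW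
      intro w' hw' z hz hza
      rcases Finset.mem_insert.mp hz with rfl | hz
      · exact absurd Relation.ReflTransGen.refl hza
      · rw [hτz z hz]
        exact hw' z hz (fun h => hza (sk_anc_trans h hxa))
    · rw [hτz a ha]
      have := hwB a ha
      simp only [B, Finset.mem_filter, Finset.mem_univ, true_and, not_not] at this
      refine Wd_mono ?_ le_rfl _ _ this
      rintro w' ⟨hw1, hw2⟩ z hz hza
      rcases Finset.mem_insert.mp hz with rfl | hz
      · rw [hτy]; exact hw2
      · rw [hτz z hz]; exact hw1 z hz hza

/-- if `(F,ρ)` is a rooted tree of depth `h ≥ 0`, `c ∈ (0,1/2)`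
and `t ≥ 1`, then every `(c,t)`-sparse graph `G` containing a
`((4/c)^(3h|V(F)|)·t, h)`-skeleton contains an induced subgraph
isomorphic to `F`. -/
theorem stmt15 (U : Type) [Fintype U] (F : SimpleGraph U) (hF : F.IsTree) (ρ : U)
    (h : ℕ) (hdepth : rootDepth F ρ = h)
    (c : ℝ) (hc0 : 0 < c) (hc2 : c < 1 / 2) (t : ℕ) (ht : 1 ≤ t)
    (V : Type) [Fintype V] (G : SimpleGraph V) (hG : CTSparse G c t)
    (hsk : HasSkeleton G ((4 / c) ^ (3 * h * Fintype.card U) * t) h) :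
    Nonempty (F ↪g G) := by
  classical
  obtain ⟨W, _, T, r, hT, hw, φ, hs⟩ := hsk
  rcases Nat.eq_zero_or_pos h with rfl | hh
  · have hsub : ∀ x : U, x = ρ := by
      intro x
      have := sk_dist_le F ρ x
      rw [hdepth] at this
      exact (hF.connected.dist_eq_zero_iff.mp (by omega)).symm
    refine ⟨⟨⟨fun _ => φ r, fun a b _ => (hsub a).trans (hsub b).symm⟩, ?_⟩⟩
    intro a b
    simp [hsub a, hsub b]
  have hq8 : 8 ≤ 4 / c := by rw [le_div_iff₀ hc0]; linarith
  have ht' : (1 : ℝ) ≤ t := by exact_mod_cast ht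
  set q : ℝ := 4 / c with hq
  set k := Fintype.card U with hk
  set d : ℝ := q ^ (3 * h * k) * t with hd
  have hk1 : 1 ≤ k := Fintype.card_pos_iff.mpr ⟨ρ⟩
  have hd0 : 0 < d := by positivity
  have main : ∀ n, 1 ≤ n → n ≤ k → ∃ (S : Finset U) (τ : U → W), S.card = n ∧ ρ ∈ S ∧
      (∀ x y, IsChild F ρ x y → y ∈ S → x ∈ S) ∧
      (∀ x ∈ S, T.dist r (τ x) = F.dist ρ x) ∧
      (∀ x ∈ S, ∀ y ∈ S, IsChild F ρ x y → IsChild T r (τ x) (τ y)) ∧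
      (∀ x ∈ S, ∀ y ∈ S, ¬ skAnc F ρ x y → ¬ skAnc F ρ y x →
        ¬ G.Adj (φ (τ x)) (φ (τ y)) ∧ φ (τ x) ≠ φ (τ y)) ∧
      (∀ x ∈ S, Wd (IsChild T r)
        (fun w => ∀ z ∈ S, ¬ skAnc F ρ z x → ¬ G.Adj (φ w) (φ (τ z)) ∧ φ w ≠ φ (τ z))
        (d / q ^ n) (h - F.dist ρ x) (τ x)) := by
    intro n hn
    induction n, hn using Nat.le_induction with
    | base =>
      intro _
      refine ⟨{ρ}, fun _ => r, by simp, by simp, ?_, ?_, ?_, ?_, ?_⟩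
      · intro x y hxy hy
        rw [Finset.mem_singleton] at hy
        subst hy
        have := hxy.2
        simp at this
      · intro x hx
        rw [Finset.mem_singleton] at hx
        subst hx; simp
      · intro x hx y hy hxy
        rw [Finset.mem_singleton] at hx hy
        subst hx; subst hy
        exact absurd hxy.1 (F.loopless.irrefl _)
      · intro x hx y hy hxy
        rw [Finset.mem_singleton] at hx hy
        subst hx; subst hy
        exact absurd Relation.ReflTransGen.refl hxy
      · intro x hx
        rw [Finset.mem_singleton] at hx
        subst hx
        refine Wd_mono (P := fun _ => True) ?_ (div_le_self hd0.le (by rw [pow_one]; linarith)) _ _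
          (Wd_base hw _ _ (by simp))
        intro w _ z hz hzx
        rw [Finset.mem_singleton] at hz
        subst hz
        exact absurd Relation.ReflTransGen.refl hzx
    | succ n hn ih =>
      intro hnk
      obtain ⟨S, τ, hS, h1, h2, h3, h4, h5, h6⟩ := ih (by omega)
      have hexp : h + k + n ≤ 3 * h * k := by nlinarith [Nat.mul_le_mul hh hk1]
      have hdn : q ^ h * q ^ k * t ≤ d / q ^ n := by
        rw [le_div_iff₀ (by positivity), hd]
        have : q ^ (h + k + n) ≤ q ^ (3 * h * k) := pow_le_pow_right₀ (by linarith) hexp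
        rw [pow_add, pow_add] at this
        nlinarith
      have hqh : 1 ≤ q ^ h := one_le_pow₀ (by linarith)
      have hqk : q ≤ q ^ k := by
        simpa using pow_le_pow_right₀ (a := q) (by linarith) hk1
      have hqq : q ^ k ≤ q ^ h * q ^ k := by nlinarith
      have hnq : (n : ℝ) < q ^ k := by
        have a1 : (k : ℝ) < 2 ^ k := by exact_mod_cast Nat.lt_two_pow_self
        have a2 : (2 : ℝ) ^ k ≤ q ^ k := pow_le_pow_left₀ (by norm_num) (by linarith) _
        have a3 : (n : ℝ) ≤ k := by exact_mod_cast (by omega : n ≤ k)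
        linarith
      have hdq : q ≤ d / q ^ n := by nlinarith
      obtain ⟨S', τ', g0, g⟩ := sk_step hF hdepth hc0 hc2 ht hG hs.1 S τ (d / q ^ n)
        (by nlinarith) (by
          refine le_trans ?_ hdq
          rw [hq]; gcongr; norm_num) (by
          rw [hS]
          refine lt_of_lt_of_le ?_ hdn
          have : 0 < q ^ h * t := by positivity
          nlinarith) h1 h2 h3 h4 h5 h6 (by
          rintro rfl
          rw [Finset.card_univ] at hS
          omega)
      refine ⟨S', τ', by omega, ?_⟩
      rw [← hq, div_div, ← pow_succ] at g
      exact g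
  obtain ⟨S, τ, hS, -, -, h3, h4, h5, -⟩ := main k hk1 le_rfl
  have hu : S = Finset.univ := (Finset.card_eq_iff_eq_univ S).mp hS
  subst hu
  have h3' : ∀ x, T.dist r (τ x) = F.dist ρ x := fun x => h3 x (Finset.mem_univ x)
  have h4' : ∀ x y, IsChild F ρ x y → IsChild T r (τ x) (τ y) :=
    fun x y => h4 x (Finset.mem_univ x) y (Finset.mem_univ y)
  have hanc : ∀ x y, skAnc F ρ x y → skAnc T r (τ x) (τ y) := by
    intro x y hxy
    exact Relation.ReflTransGen.lift τ h4' _ _ hxy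
  have key : ∀ x y, skAnc F ρ x y →
      (φ (τ x) = φ (τ y) → x = y) ∧ (G.Adj (φ (τ x)) (φ (τ y)) ↔ F.Adj x y) := by
    intro x y hxy
    obtain ⟨k1, k2⟩ := sk_path hT hw hd0 hh hs (hanc x y hxy)
    refine ⟨fun he => ?_, ?_⟩
    · have := k1 he
      apply sk_anc_eq hF hxy
      rw [← h3', ← h3', this]
    · rw [k2]
      have hle := sk_anc_dist hF hxy
      constructor
      · intro hadj
        rcases hT.dist_eq_dist_add_one_of_adj r hadj with e | e
        · rw [h3', h3'] at e; omega
        · rw [h3', h3'] at e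
          exact dist_eq_one_iff_adj.mp (by omega)
      · intro hadj
        rcases hF.dist_eq_dist_add_one_of_adj ρ hadj with e | e
        · omega
        · exact (h4' x y ⟨hadj, e⟩).1
  have key2 : ∀ x y, (φ (τ x) = φ (τ y) → x = y) ∧ (G.Adj (φ (τ x)) (φ (τ y)) ↔ F.Adj x y) := by
    intro x y
    by_cases hxy : skAnc F ρ x y
    · exact key x y hxy
    by_cases hyx : skAnc F ρ y x
    · obtain ⟨k1, k2⟩ := key y x hyx
      exact ⟨fun he => (k1 he.symm).symm, by rw [G.adj_comm, F.adj_comm]; exact k2⟩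
    obtain ⟨k1, k2⟩ := h5 x (Finset.mem_univ x) y (Finset.mem_univ y) hxy hyx
    refine ⟨fun he => absurd he k2, fun he => absurd he k1, fun hadj => ?_⟩
    rcases hF.dist_eq_dist_add_one_of_adj ρ hadj with e | e
    · exact absurd (Relation.ReflTransGen.single ⟨hadj.symm, e⟩) hyx
    · exact absurd (Relation.ReflTransGen.single ⟨hadj, e⟩) hxy
  exact ⟨⟨⟨fun x => φ (τ x), fun x y he => (key2 x y).1 he⟩, fun {x y} => (key2 x y).2⟩⟩
end

section
/- Let H be a graph with the property that for every χ-bounded hereditary class 𝒢 of graphs, the class of H-free graphs in 𝒢 is linearly χ-bounded. Then the complement of H is a forest with no induced path on 5 vertices. -/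
open SimpleGraph

/-- The chromatic number of a graph as a natural number. -/
noncomputable def chromNum {V : Type*} (G : SimpleGraph V) : ℕ :=
  G.chromaticNumber.toNat

/-- The stability (independence) number of a graph. -/
noncomputable def indepNum {V : Type*} (G : SimpleGraph V) : ℕ := Gᶜ.cliqueNum

/-- A stable (independent) set in a graph. -/
def IsStableSet {V : Type*} (G : SimpleGraph V) (S : Finset V) : Prop :=
  ∀ u ∈ S, ∀ v ∈ S, ¬ G.Adj u v

/-- The Ramsey number `R(s,w)`: the least `n ≥ 1` such that every graph on `n`
vertices contains a stable set of size `s` or a clique of size `w`. -/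
noncomputable def ramsey (s w : ℕ) : ℕ :=
  sInf {n : ℕ | 1 ≤ n ∧ ∀ G : SimpleGraph (Fin n),
    (∃ S : Finset (Fin n), IsStableSet G S ∧ S.card = s) ∨
    (∃ S : Finset (Fin n), G.IsNClique w S)}

/-- `G` has no induced subgraph isomorphic to `H`. -/
def IndFree {W V : Type*} (H : SimpleGraph W) (G : SimpleGraph V) : Prop :=
  ¬ Nonempty (H ↪g G)

/-- A class of (finite) graphs, given by a predicate on graphs on `Fin n`. -/
abbrev GraphClass := ∀ n : ℕ, SimpleGraph (Fin n) → Prop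

/-- A class of graphs is hereditary if it is closed under taking induced
subgraphs (up to isomorphism). -/
def Hereditary (C : GraphClass) : Prop :=
  ∀ (n : ℕ) (G : SimpleGraph (Fin n)) (m : ℕ) (H : SimpleGraph (Fin m)),
    C n G → Nonempty (H ↪g G) → C m H

/-- A class of graphs is χ-bounded if some function `f : ℕ → ℝ≥0` satisfies
`χ(G) ≤ f(ω(G))` for every graph `G` of the class. -/
def ChiBounded (C : GraphClass) : Prop :=
  ∃ f : ℕ → ℝ, (∀ n, 0 ≤ f n) ∧
    ∀ (n : ℕ) (G : SimpleGraph (Fin n)), C n G →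
      (chromNum G : ℝ) ≤ f G.cliqueNum

/-- A class of graphs is linearly χ-bounded if there is `B ≥ 1` with
`χ(G) ≤ B·ω(G)` for every graph `G` of the class. -/
def LinearlyChiBounded (C : GraphClass) : Prop :=
  ∃ B : ℝ, 1 ≤ B ∧ ∀ (n : ℕ) (G : SimpleGraph (Fin n)), C n G →
    (chromNum G : ℝ) ≤ B * G.cliqueNum


lemma aux_clique_le {n b : ℕ} (G : SimpleGraph (Fin n))
    (h : ∀ S : Finset (Fin n), G.IsClique S → S.card ≤ b) : G.cliqueNum ≤ b := by
  obtain ⟨S, hS⟩ := G.exists_isNClique_cliqueNum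
  rw [← hS.card_eq]
  exact h S hS.isClique

lemma aux_le_clique {n : ℕ} (G : SimpleGraph (Fin n)) (S : Finset (Fin n))
    (h : G.IsClique S) : S.card ≤ G.cliqueNum :=
  h.card_le_cliqueNum

lemma aux_colorable {n : ℕ} (G : SimpleGraph (Fin n)) : G.Colorable (chromNum G) := by
  have h : G.Colorable n := by
    have := G.colorable_of_fintype
    simpa using this
  exact SimpleGraph.colorable_chromaticNumber h

lemma aux_chrom_le {n k : ℕ} (G : SimpleGraph (Fin n)) (h : G.Colorable k) :
    chromNum G ≤ k := by
  have h1 := h.chromaticNumber_le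
  unfold chromNum
  exact ENat.toNat_le_of_le_natCast h1

lemma aux_card_le {n a : ℕ} (G : SimpleGraph (Fin n))
    (h : ∀ S : Finset (Fin n), (∀ u ∈ S, ∀ v ∈ S, ¬ G.Adj u v) → S.card ≤ a) :
    n ≤ chromNum G * a := by
  classical
  obtain ⟨c⟩ := aux_colorable G
  have := Finset.card_le_mul_card_image_of_maps_to (s := (Finset.univ : Finset (Fin n)))
    (t := (Finset.univ : Finset (Fin (chromNum G)))) (f := c) (fun _ _ => Finset.mem_univ _) a
    (by
      intro b _
      apply h
      intro u hu v hv huv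
      simp only [Finset.mem_filter, Finset.mem_univ, true_and] at hu hv
      exact c.valid huv (hu.trans hv.symm))
  simpa [mul_comm] using this

/-- Graphs with stability number at most two. -/
def AlphaTwo : GraphClass := fun n G => ∀ a b c : Fin n, a ≠ b → a ≠ c → b ≠ c →
  G.Adj a b ∨ G.Adj a c ∨ G.Adj b c

lemma alphaTwo_hereditary : Hereditary AlphaTwo := by
  rintro n G m H hG ⟨φ⟩ a b c hab hac hbc
  have := hG (φ a) (φ b) (φ c) (φ.injective.ne hab) (φ.injective.ne hac) (φ.injective.ne hbc)
  simpa using this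

lemma alphaTwo_chiBounded : ChiBounded AlphaTwo := by
  classical
  refine ⟨fun w => (w : ℝ) + w * w, fun n => by positivity, ?_⟩
  intro n G hG
  have h1 : chromNum G ≤ n := by
    apply aux_chrom_le
    simpa using G.colorable_of_fintype
  have h2 : n ≤ G.cliqueNum + G.cliqueNum * G.cliqueNum := by
    obtain ⟨K, hK⟩ := G.exists_isNClique_cliqueNum
    have hcov : (Finset.univ : Finset (Fin n)) ⊆
        K ∪ K.biUnion (fun v => Finset.univ.filter (fun u => u ≠ v ∧ ¬ G.Adj v u)) := by
      intro u _
      by_contra hu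
      simp only [Finset.mem_union, Finset.mem_biUnion, Finset.mem_filter, Finset.mem_univ,
        true_and, not_or, not_exists, not_and, not_not] at hu
      obtain ⟨hu1, hu2⟩ := hu
      have hc : G.IsClique (insert u K : Finset (Fin n)) := by
        rw [Finset.coe_insert, SimpleGraph.isClique_insert]
        refine ⟨hK.isClique, fun b hb hne => (hu2 b hb hne).symm⟩
      have := aux_le_clique G _ hc
      rw [Finset.card_insert_of_notMem hu1, hK.card_eq] at this
      omega
    have := Finset.card_le_card hcov
    rw [Finset.card_univ, Fintype.card_fin] at this
    refine this.trans ((Finset.card_union_le _ _).trans ?_)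
    rw [hK.card_eq]
    gcongr
    refine (Finset.card_biUnion_le_card_mul _ _ G.cliqueNum ?_).trans (by rw [hK.card_eq])
    intro v _
    apply aux_le_clique
    intro x hx y hy hxy
    simp only [Finset.coe_filter, Finset.mem_univ, true_and, Set.mem_ofPred_eq] at hx hy
    have := hG v x y hx.1.symm hy.1.symm hxy
    tauto
  have h3 := h1.trans h2
  have h4 : (chromNum G : ℝ) ≤ ((G.cliqueNum + G.cliqueNum * G.cliqueNum : ℕ) : ℝ) := by
    exact_mod_cast h3
  simpa using h4

section field
variable {p : ℕ} [Fact p.Prime]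

lemma fld_indep (S : Finset (ZMod p × ZMod p))
    (hS : ∀ u ∈ S, ∀ v ∈ S, (u.1 - v.1) ^ 2 ≠ u.2 + v.2) (h2 : (2 : ZMod p) ≠ 0) :
    S.card ^ 2 ≤ p ^ 3 := by
  classical
  obtain ⟨r, hr⟩ : ∃ r : ZMod p × ZMod p → ZMod p × ZMod p → Prop, ∀ u z, r u z ↔ (u.1 - z.1) ^ 2 = u.2 + z.2 :=
    ⟨_, fun _ _ => Iff.rfl⟩
  let N : ZMod p × ZMod p → ℤ := fun z => ∑ u ∈ S, if r u z then 1 else 0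
  have hcount : ∀ u : ZMod p × ZMod p, (∑ z : ZMod p × ZMod p, if r u z then (1 : ℤ) else 0) = p := by
    intro u
    rw [Fintype.sum_prod_type]
    have : ∀ c : ZMod p, (∑ s : ZMod p, if r u (c, s) then (1 : ℤ) else 0) = 1 := by
      intro c
      have : ∀ s : ZMod p, r u (c, s) ↔ s = (u.1 - c) ^ 2 - u.2 := by
        intro s
        simp only [hr]
        constructor
        · intro h; rw [h]; ring
        · intro h; rw [h]; ring
      simp only [this]
      simp
    simp only [this]
    simp [ZMod.card]
  have hpair : ∀ u v : ZMod p × ZMod p, u ≠ v →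
      (∑ z : ZMod p × ZMod p, (if r u z then (1 : ℤ) else 0) * (if r v z then (1 : ℤ) else 0)) ≤ 1 := by
    intro u v huv
    have : ∀ z : ZMod p × ZMod p, (if r u z then (1 : ℤ) else 0) * (if r v z then (1 : ℤ) else 0)
        = if (r u z ∧ r v z) then 1 else 0 := by
      intro z; split_ifs <;> simp_all
    simp only [this]
    rw [Finset.sum_boole]
    have : (Finset.univ.filter (fun z => r u z ∧ r v z)).card ≤ 1 := by
      rw [Finset.card_le_one]
      rintro ⟨c, s⟩ hz ⟨c', s'⟩ hz'
      simp only [Finset.mem_filter, Finset.mem_univ, true_and, hr] at hz hz'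
      obtain ⟨e1, e2⟩ := hz
      obtain ⟨e3, e4⟩ := hz'
      have hne : u.1 ≠ v.1 := by
        intro h
        apply huv
        refine Prod.ext h ?_
        rw [h] at e1
        have := e1.symm.trans e2
        exact add_right_cancel this
      have hc : (2 * (u.1 - v.1)) * (c - c') = 0 := by
        linear_combination -e1 + e2 + e3 - e4
      have hc' : c = c' := by
        rcases mul_eq_zero.mp hc with h | h
        · rcases mul_eq_zero.mp h with h | h
          · exact absurd h h2
          · exact absurd (sub_eq_zero.mp h) hne
        · exact sub_eq_zero.mp h
      subst hc'
      refine Prod.ext rfl ?_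
      exact add_left_cancel (e1.symm.trans e3)
    exact_mod_cast this
  have hsum : ∑ z, N z = p * S.card := by
    simp only [N]
    rw [Finset.sum_comm]
    simp only [hcount]
    simp [mul_comm]
  have hsq : ∑ z, N z ^ 2 ≤ p * S.card + S.card ^ 2 := by
    have e : ∀ z, N z ^ 2 = ∑ u ∈ S, ∑ v ∈ S,
        (if r u z then (1 : ℤ) else 0) * (if r v z then (1 : ℤ) else 0) := by
      intro z
      simp only [N, sq]
      rw [Finset.sum_mul_sum]
    simp only [e]
    rw [Finset.sum_comm]
    have : ∀ u ∈ S, (∑ z, ∑ v ∈ S,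
        (if r u z then (1 : ℤ) else 0) * (if r v z then (1 : ℤ) else 0)) ≤ p + S.card := by
      intro u hu
      rw [Finset.sum_comm]
      have : ∀ v ∈ S, (∑ z, (if r u z then (1 : ℤ) else 0) * (if r v z then (1 : ℤ) else 0))
          ≤ (if u = v then (p : ℤ) else 0) + 1 := by
        intro v _
        by_cases h : u = v
        · subst h
          have : ∀ z, (if r u z then (1 : ℤ) else 0) * (if r u z then (1 : ℤ) else 0)
            = if r u z then (1 : ℤ) else 0 := by intro z; split_ifs <;> simp
          simp only [this, hcount]
          simp
        · have := hpair u v h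
          simpa [h] using this
      refine (Finset.sum_le_sum this).trans ?_
      rw [Finset.sum_add_distrib]
      simp [hu]
    refine (Finset.sum_le_sum this).trans ?_
    simp
    nlinarith
  have hcardK : (∑ _z : ZMod p × ZMod p, (1 : ℤ)) = p ^ 2 := by
    simp [ZMod.card, sq]
  have hvar : ∑ z, ((p : ℤ) * N z - S.card) ^ 2 ≤ p ^ 3 * S.card := by
    have e : ∀ z, ((p : ℤ) * N z - S.card) ^ 2
        = p ^ 2 * N z ^ 2 - 2 * p * S.card * N z + S.card ^ 2 * 1 := by intro z; ring
    simp only [e]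
    rw [Finset.sum_add_distrib, Finset.sum_sub_distrib, ← Finset.mul_sum, ← Finset.mul_sum,
      ← Finset.mul_sum, hsum, hcardK]
    have := mul_le_mul_of_nonneg_left hsq (sq_nonneg (p : ℤ))
    nlinarith
  have hlow : (S.card : ℤ) * (S.card : ℤ) ^ 2 ≤ ∑ z, ((p : ℤ) * N z - S.card) ^ 2 := by
    have : ∑ z ∈ S, ((p : ℤ) * N z - S.card) ^ 2 ≤ ∑ z, ((p : ℤ) * N z - S.card) ^ 2 :=
      Finset.sum_le_sum_of_subset_of_nonneg (Finset.subset_univ _) (fun _ _ _ => sq_nonneg _)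
    refine le_trans (le_of_eq ?_) this
    rw [Finset.sum_congr rfl (g := fun _ => (S.card : ℤ) ^ 2)]
    · simp
    · intro z hz
      have : N z = 0 := by
        apply Finset.sum_eq_zero
        intro u hu
        rw [if_neg (fun h => hS u hu z hz ((hr u z).mp h))]
      rw [this]; ring
  have := hlow.trans hvar
  rcases Nat.eq_zero_or_pos S.card with h | h
  · rw [h]; simp
  · have h' : (0 : ℤ) < S.card := by exact_mod_cast h
    have : (S.card : ℤ) ^ 2 ≤ p ^ 3 := by
      by_contra hc
      push Not at hc
      nlinarith
    exact_mod_cast this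

end field

section field2
variable {p : ℕ} [Fact p.Prime]

/-- Vertices of the triangle-free and `C_4`-free graph: pairs whose second entry is a nonzero
square. -/
abbrev FV (p : ℕ) := {v : ZMod p × ZMod p // IsSquare v.2 ∧ v.2 ≠ 0}

lemma fld_no_triangle (hneg : ¬ IsSquare (-1 : ZMod p)) (h2 : (2 : ZMod p) ≠ 0)
    (u v w : FV p) (h1 : (u.1.1 - v.1.1) ^ 2 = u.1.2 + v.1.2)
    (h3 : (u.1.1 - w.1.1) ^ 2 = u.1.2 + w.1.2)
    (h4 : (v.1.1 - w.1.1) ^ 2 = v.1.2 + w.1.2) : False := by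
  obtain ⟨⟨a, r⟩, ⟨r', hr⟩, hr0⟩ := u
  obtain ⟨⟨c, s⟩, ⟨s', hs⟩, hs0⟩ := v
  obtain ⟨⟨e, t⟩, ⟨t', ht⟩, ht0⟩ := w
  change r = _ at hr
  change s = _ at hs
  change t = _ at ht
  change r ≠ 0 at hr0
  change s ≠ 0 at hs0
  change t ≠ 0 at ht0
  simp only at h1 h3 h4
  have e1 : (a - c) * (c - e) = -s := by
    apply mul_left_cancel₀ h2
    linear_combination h3 - h1 - h4
  have e2 : (a - c) * (a - e) = r := by
    apply mul_left_cancel₀ h2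
    linear_combination h1 + h3 - h4
  have e3 : (c - e) * (a - e) = t := by
    apply mul_left_cancel₀ h2
    linear_combination - h1 + h3 + h4
  apply hneg
  have hr' : r' ≠ 0 := by rintro rfl; simp at hr; exact hr0 hr
  have hs' : s' ≠ 0 := by rintro rfl; simp at hs; exact hs0 hs
  have ht' : t' ≠ 0 := by rintro rfl; simp at ht; exact ht0 ht
  refine ⟨(a - c) * (c - e) * (a - e) / (r' * s' * t'), ?_⟩
  field_simp
  have : ((a - c) * (c - e) * (a - e)) ^ 2 = - (r * s * t) := by
    calc ((a - c) * (c - e) * (a - e)) ^ 2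
        = ((a - c) * (c - e)) * ((a - c) * (a - e)) * ((c - e) * (a - e)) := by ring
      _ = - (r * s * t) := by rw [e1, e2, e3]; ring
  rw [hr, hs, ht] at this
  linear_combination - this

lemma fld_no_c4 (h2 : (2 : ZMod p) ≠ 0) (u v x y : ZMod p × ZMod p) (huv : u ≠ v)
    (e1 : (u.1 - x.1) ^ 2 = u.2 + x.2) (e2 : (v.1 - x.1) ^ 2 = v.2 + x.2)
    (e3 : (u.1 - y.1) ^ 2 = u.2 + y.2) (e4 : (v.1 - y.1) ^ 2 = v.2 + y.2) : x = y := by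
  obtain ⟨c, s⟩ := x
  obtain ⟨c', s'⟩ := y
  simp only at *
  have hne : u.1 ≠ v.1 := by
    intro h
    apply huv
    refine Prod.ext h ?_
    rw [h] at e1
    have := e1.symm.trans e2
    exact add_right_cancel this
  have hc : (2 * (u.1 - v.1)) * (c - c') = 0 := by
    linear_combination -e1 + e2 + e3 - e4
  have hc' : c = c' := by
    rcases mul_eq_zero.mp hc with h | h
    · rcases mul_eq_zero.mp h with h | h
      · exact absurd h h2
      · exact absurd (sub_eq_zero.mp h) hne
    · exact sub_eq_zero.mp h
  subst hc'
  refine Prod.ext rfl ?_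
  exact add_left_cancel (e1.symm.trans e3)

lemma fld_card [Fintype (FV p)] : p * (p - 1) ≤ 2 * Fintype.card (FV p) := by
  classical
  -- map (a, x) with x ≠ 0 to (a, x²)
  let f : ZMod p × {x : ZMod p // x ≠ 0} → FV p := fun z =>
    ⟨(z.1, z.2.1 * z.2.1), ⟨z.2.1, rfl⟩, mul_ne_zero z.2.2 z.2.2⟩
  have := Finset.card_le_mul_card_image_of_maps_to
    (s := (Finset.univ : Finset (ZMod p × {x : ZMod p // x ≠ 0})))
    (t := (Finset.univ : Finset (FV p))) (f := f) (fun _ _ => Finset.mem_univ _) 2 (by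
      intro b _
      by_contra hc
      push Not at hc
      obtain ⟨x, y, z, hx, hy, hz, hxy, hxz, hyz⟩ := Finset.two_lt_card_iff.mp hc
      simp only [Finset.mem_filter, Finset.mem_univ, true_and] at hx hy hz
      obtain ⟨a, x, hx0⟩ := x
      obtain ⟨a', y, hy0⟩ := y
      obtain ⟨a'', z, hz0⟩ := z
      have h1 := hx.trans hy.symm
      have h2 := hx.trans hz.symm
      simp only [f, Subtype.mk.injEq, Prod.mk.injEq] at h1 h2
      obtain ⟨rfl, h1⟩ := h1
      obtain ⟨rfl, h2⟩ := h2
      simp only [ne_eq, Prod.mk.injEq, Subtype.mk.injEq, true_and] at hxy hxz hyz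
      rcases mul_self_eq_mul_self_iff.mp h1 with h | h
      · exact hxy h
      · rcases mul_self_eq_mul_self_iff.mp h2 with h' | h'
        · exact hxz h'
        · exact hyz (neg_injective (h.symm.trans h')))
  have hc : Fintype.card {x : ZMod p // x ≠ 0} = p - 1 := by
    rw [Fintype.card_subtype_compl]
    simp [ZMod.card]
  simp only [Finset.card_univ, Fintype.card_prod, ZMod.card, hc] at this
  exact this

end field2

theorem part_A (W : Type) [Fintype W] (H : SimpleGraph W)
    (hH : ∀ C : GraphClass, Hereditary C → ChiBounded C →
      LinearlyChiBounded (fun n G => C n G ∧ IndFree H G))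
    (hbad : (∃ a b c, Hᶜ.Adj a b ∧ Hᶜ.Adj a c ∧ Hᶜ.Adj b c) ∨
      (∃ a b x y, a ≠ b ∧ x ≠ y ∧ Hᶜ.Adj a x ∧ Hᶜ.Adj b x ∧ Hᶜ.Adj a y ∧ Hᶜ.Adj b y)) :
    False := by
  classical
  obtain ⟨B, hB1, hB⟩ := hH _ alphaTwo_hereditary alphaTwo_chiBounded
  obtain ⟨M, hM⟩ := exists_nat_gt (16 * B ^ 2 + 2)
  obtain ⟨p, hpM, hp, hp4⟩ := Nat.forall_exists_prime_gt_and_eq_mod (q := 4) (a := 3)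
    (by decide) M
  haveI : Fact p.Prime := ⟨hp⟩
  have hp4' : p % 4 = 3 := by
    have : ((p : ℕ) : ZMod 4) = ((3 : ℕ) : ZMod 4) := by simpa using hp4
    have := (ZMod.natCast_eq_natCast_iff' _ _ _).mp this
    simpa using this
  have hneg : ¬ IsSquare (-1 : ZMod p) := by
    rw [ZMod.exists_sq_eq_neg_one_iff]
    simp [hp4']
  have h2 : (2 : ZMod p) ≠ 0 := by
    intro h
    have : ((2 : ℕ) : ZMod p) = 0 := by exact_mod_cast h
    rw [ZMod.natCast_eq_zero_iff] at this
    have := Nat.le_of_dvd (by norm_num) this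
    have := hp.two_le
    have : p = 2 := by omega
    omega
  haveI : Fintype (FV p) := Fintype.ofFinite _
  let e := (Fintype.equivFin (FV p)).symm
  set n := Fintype.card (FV p) with hn
  let F : Fin n → Fin n → Prop := fun i j =>
    ((e i).1.1 - (e j).1.1) ^ 2 = (e i).1.2 + (e j).1.2
  have Fsymm : ∀ i j, F i j → F j i := by
    intro i j h
    simp only [F] at *
    linear_combination h
  have Fself : ∀ i, ¬ F i i := by
    intro i h
    simp only [F] at h
    have : 2 * (e i).1.2 = 0 := by linear_combination -h
    rcases mul_eq_zero.mp this with h | h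
    · exact h2 h
    · exact (e i).2.2 h
  let G : SimpleGraph (Fin n) :=
    { Adj := fun i j => i ≠ j ∧ ¬ F i j
      symm := ⟨fun i j h => ⟨h.1.symm, fun h' => h.2 (Fsymm _ _ h')⟩⟩
      loopless := ⟨fun i h => h.1 rfl⟩ }
  have hGadj : ∀ i j, G.Adj i j ↔ i ≠ j ∧ ¬ F i j := fun _ _ => Iff.rfl
  have hA : AlphaTwo n G := by
    intro a b c hab hac hbc
    by_contra hcon
    simp only [hGadj] at hcon
    have h1 : F a b ∧ F a c ∧ F b c := by tauto
    exact fld_no_triangle hneg h2 (e a) (e b) (e c) h1.1 h1.2.1 h1.2.2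
  have hfree : IndFree H G := by
    rintro ⟨φ⟩
    have key : ∀ a b, Hᶜ.Adj a b → F (φ a) (φ b) := by
      intro a b hab
      rw [SimpleGraph.compl_adj] at hab
      by_contra hF
      apply hab.2
      rw [← φ.map_adj_iff, hGadj]
      exact ⟨φ.injective.ne hab.1, hF⟩
    rcases hbad with ⟨a, b, c, h1, h3, h4⟩ | ⟨a, b, x, y, hab, hxy, h1, h3, h4, h5⟩
    · exact fld_no_triangle hneg h2 _ _ _ (key _ _ h1) (key _ _ h3) (key _ _ h4)
    · have := fld_no_c4 h2 (e (φ a)).1 (e (φ b)).1 (e (φ x)).1 (e (φ y)).1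
        (fun h => hab (φ.injective (e.injective (Subtype.ext h))))
        (key _ _ h1) (key _ _ h3) (key _ _ h4) (key _ _ h5)
      exact hxy (φ.injective (e.injective (Subtype.ext this)))
  have hchi := hB n G ⟨hA, hfree⟩
  have hom : G.cliqueNum ^ 2 ≤ p ^ 3 := by
    obtain ⟨S, hS⟩ := G.exists_isNClique_cliqueNum
    have hcard : (S.image (fun i => (e i).1)).card = S.card :=
      Finset.card_image_of_injective _ (fun i j h => e.injective (Subtype.ext h))
    rw [← hS.card_eq, ← hcard]
    apply fld_indep _ _ h2
    intro u hu v hv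
    obtain ⟨i, hi, rfl⟩ := Finset.mem_image.mp hu
    obtain ⟨j, hj, rfl⟩ := Finset.mem_image.mp hv
    intro h
    by_cases hij : i = j
    · subst hij; exact Fself i h
    · exact (hS.isClique hi hj hij).2 h
  have hnle : n ≤ chromNum G * 2 := by
    apply aux_card_le
    intro S hS
    by_contra hc
    push Not at hc
    obtain ⟨x, y, z, hx, hy, hz, hxy, hxz, hyz⟩ := Finset.two_lt_card_iff.mp hc
    have := hA x y z hxy hxz hyz
    rcases this with h | h | h
    · exact hS _ hx _ hy h
    · exact hS _ hx _ hz h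
    · exact hS _ hy _ hz h
  have hcard := fld_card (p := p)
  rw [← hn] at hcard
  have hp1 : 1 ≤ p := hp.one_le
  have hcR : (p : ℝ) * (p - 1) ≤ 2 * n := by
    have : ((p * (p - 1) : ℕ) : ℝ) ≤ ((2 * n : ℕ) : ℝ) := by exact_mod_cast hcard
    push_cast [Nat.cast_sub hp1] at this
    exact this
  have hnR : (n : ℝ) ≤ chromNum G * 2 := by exact_mod_cast hnle
  have homR : (G.cliqueNum : ℝ) ^ 2 ≤ (p : ℝ) ^ 3 := by exact_mod_cast hom
  have hpR : 16 * B ^ 2 + 2 < (p : ℝ) := hM.trans (by exact_mod_cast hpM)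
  have hpp : (0 : ℝ) < p := by nlinarith [sq_nonneg B]
  have k1 : (p : ℝ) * (p - 1) ≤ 4 * B * G.cliqueNum := by linarith
  have k0 : (0 : ℝ) ≤ (p : ℝ) * (p - 1) := by
    apply mul_nonneg hpp.le
    nlinarith [sq_nonneg B]
  have k2 : ((p : ℝ) * (p - 1)) ^ 2 ≤ (4 * B * G.cliqueNum) ^ 2 := by
    gcongr
  have k3 : (4 * B * (G.cliqueNum : ℝ)) ^ 2 ≤ 16 * B ^ 2 * (p : ℝ) ^ 3 := by
    have := mul_le_mul_of_nonneg_left homR (by positivity : 0 ≤ 16 * B ^ 2)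
    linarith [this]
  have k4 : (p : ℝ) ^ 2 * ((p - 1) ^ 2) ≤ (p : ℝ) ^ 2 * (16 * B ^ 2 * p) := by
    nlinarith
  have k5 := le_of_mul_le_mul_left k4 (by positivity)
  have k6 : 16 * B ^ 2 * p < (p - 2) * (p : ℝ) := by
    apply mul_lt_mul_of_pos_right _ hpp
    linarith
  nlinarith

section lists
variable {m : ℕ}

/-- Adjacency in the infinite iterated substitution power of the graph with relation `R`. -/
def ladj (R : Fin m → Fin m → Prop) : List (Fin m) → List (Fin m) → Prop
  | i :: x, j :: y => (i ≠ j ∧ R i j) ∨ (i = j ∧ ladj R x y)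
  | _, _ => False

lemma ladj_cons (R : Fin m → Fin m → Prop) (i j x y) :
    ladj R (i :: x) (j :: y) ↔ (i ≠ j ∧ R i j) ∨ (i = j ∧ ladj R x y) := by
  simp [ladj]

lemma ladj_symm (R : Fin m → Fin m → Prop) (hR : ∀ i j, R i j → R j i) :
    ∀ x y, ladj R x y → ladj R y x
  | [], _, h => by simp [ladj] at h
  | _ :: _, [], h => by simp [ladj] at h
  | i :: x, j :: y, h => by
    rw [ladj_cons] at *
    rcases h with ⟨h1, h2⟩ | ⟨h1, h2⟩
    · exact Or.inl ⟨h1.symm, hR _ _ h2⟩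
    · exact Or.inr ⟨h1.symm, ladj_symm R hR _ _ h2⟩

lemma ladj_irrefl (R : Fin m → Fin m → Prop) : ∀ x, ¬ ladj R x x
  | [], h => by simp [ladj] at h
  | i :: x, h => by
    rw [ladj_cons] at h
    rcases h with ⟨h1, h2⟩ | ⟨h1, h2⟩
    · exact h1 rfl
    · exact ladj_irrefl R x h2

lemma ladj_not (R : Fin m → Fin m → Prop) : ∀ x y : List (Fin m), x.length = y.length → x ≠ y →
    ¬ ladj R x y → ladj (fun i j => ¬ R i j) x y
  | [], [], _, h, _ => absurd rfl h
  | [], _ :: _, h, _, _ => by simp at h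
  | _ :: _, [], h, _, _ => by simp at h
  | i :: x, j :: y, hl, hne, h => by
    rw [ladj_cons] at *
    by_cases hij : i = j
    · subst hij
      refine Or.inr ⟨rfl, ladj_not R x y (by simpa using hl) (fun h => hne (by rw [h])) ?_⟩
      intro h'
      exact h (Or.inr ⟨rfl, h'⟩)
    · exact Or.inl ⟨hij, fun h' => h (Or.inl ⟨hij, h'⟩)⟩

/-- Tails of members of `S` beginning with `i`. -/
noncomputable def part (S : Finset (List (Fin m))) (i : Fin m) : Finset (List (Fin m)) :=
  S.preimage (List.cons i) (List.cons_injective.injOn)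

lemma mem_part (S : Finset (List (Fin m))) (i : Fin m) (x) : x ∈ part S i ↔ i :: x ∈ S := by
  simp [part]

lemma clique_pow (R : Fin m → Fin m → Prop) (b : ℕ)
    (hb : ∀ I : Finset (Fin m), (∀ i ∈ I, ∀ j ∈ I, i ≠ j → R i j) → I.card ≤ b) :
    ∀ (k : ℕ) (T : Finset (List (Fin m))), (∀ x ∈ T, x.length = k) →
      (∀ x ∈ T, ∀ y ∈ T, x ≠ y → ladj R x y) → T.card ≤ b ^ k := by
  classical
  intro k
  induction k with
  | zero =>
    intro T hT _
    rw [pow_zero, Finset.card_le_one]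
    intro x hx y hy
    rw [List.length_eq_zero_iff.mp (hT x hx), List.length_eq_zero_iff.mp (hT y hy)]
  | succ k ih =>
    intro T hT hc
    let I : Finset (Fin m) := Finset.univ.filter (fun i => (part T i).Nonempty)
    have hI : I.card ≤ b := by
      apply hb
      intro i hi j hj hij
      simp only [I, Finset.mem_filter, Finset.mem_univ, true_and] at hi hj
      obtain ⟨x, hx⟩ := hi
      obtain ⟨y, hy⟩ := hj
      rw [mem_part] at hx hy
      have := hc _ hx _ hy (by simp [hij])
      rw [ladj_cons] at this
      tauto
    have hsub : T ⊆ I.biUnion (fun i => (part T i).image (List.cons i)) := by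
      intro z hz
      have hl := hT z hz
      cases z with
      | nil => simp at hl
      | cons i x =>
        have : x ∈ part T i := (mem_part _ _ _).mpr hz
        simp only [Finset.mem_biUnion, Finset.mem_image, I, Finset.mem_filter, Finset.mem_univ,
          true_and]
        exact ⟨i, ⟨x, this⟩, x, this, rfl⟩
    refine (Finset.card_le_card hsub).trans ?_
    refine (Finset.card_biUnion_le_card_mul _ _ (b ^ k) ?_).trans ?_
    · intro i _
      refine Finset.card_image_le.trans (ih _ ?_ ?_)
      · intro x hx
        have := hT _ ((mem_part _ _ _).mp hx)
        simpa using this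
      · intro x hx y hy hxy
        have := hc _ ((mem_part _ _ _).mp hx) _ ((mem_part _ _ _).mp hy) (by simp [hxy])
        rw [ladj_cons] at this
        tauto
    · rw [pow_succ, mul_comm]
      gcongr

lemma color_pow (R : Fin m → Fin m → Prop) (hm : 0 < m) (hR : ∀ i j, R i j → R j i) :
    ∀ (k w : ℕ) (S : Finset (List (Fin m))), (∀ x ∈ S, x.length ≤ k) →
      (∀ T ⊆ S, (∀ x ∈ T, ∀ y ∈ T, x ≠ y → ladj R x y) → T.card ≤ w) →
      ∃ c : List (Fin m) → ℕ, (∀ x ∈ S, c x < m ^ w) ∧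
        ∀ x ∈ S, ∀ y ∈ S, ladj R x y → c x ≠ c y := by
  classical
  intro k
  induction k with
  | zero =>
    intro w S hS _
    refine ⟨fun _ => 0, fun _ _ => by positivity, ?_⟩
    intro x hx y _ h
    have := hS x hx
    have : x = [] := List.length_eq_zero_iff.mp (by omega)
    subst this
    simp [ladj] at h
  | succ k ih =>
    intro w S hS hcl
    let busy : Fin m → Prop := fun i => ∃ j, i ≠ j ∧ R i j ∧ (part S j).Nonempty
    have hlen : ∀ i, ∀ x ∈ part S i, x.length ≤ k := by
      intro i x hx
      have := hS _ ((mem_part _ _ _).mp hx)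
      simpa using this
    have hT : ∀ i, ∀ T ⊆ part S i, (∀ x ∈ T, ∀ y ∈ T, x ≠ y → ladj R x y) →
        T.card ≤ w ∧ (busy i → T.card + 1 ≤ w) := by
      intro i T hTs hTc
      have hc : (T.image (List.cons i)).card = T.card :=
        Finset.card_image_of_injective _ List.cons_injective
      have hsub : T.image (List.cons i) ⊆ S := by
        intro z hz
        obtain ⟨x, hx, rfl⟩ := Finset.mem_image.mp hz
        exact (mem_part _ _ _).mp (hTs hx)
      have hcl1 : ∀ x ∈ T.image (List.cons i), ∀ y ∈ T.image (List.cons i), x ≠ y →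
          ladj R x y := by
        intro x hx y hy hxy
        obtain ⟨x, hx', rfl⟩ := Finset.mem_image.mp hx
        obtain ⟨y, hy', rfl⟩ := Finset.mem_image.mp hy
        rw [ladj_cons]
        exact Or.inr ⟨rfl, hTc x hx' y hy' (fun h => hxy (by rw [h]))⟩
      refine ⟨?_, ?_⟩
      · rw [← hc]
        exact hcl _ hsub hcl1
      · rintro ⟨j, hij, hRij, y, hy⟩
        rw [mem_part] at hy
        have hnot : (j :: y) ∉ T.image (List.cons i) := by
          intro h
          obtain ⟨x, _, hx⟩ := Finset.mem_image.mp h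
          exact hij (List.cons.inj hx).1
        rw [← hc, ← Finset.card_insert_of_notMem hnot]
        apply hcl
        · exact Finset.insert_subset hy hsub
        · have hadj : ∀ x ∈ T.image (List.cons i), ladj R x (j :: y) := by
            intro x hx
            obtain ⟨x, hx, rfl⟩ := Finset.mem_image.mp hx
            rw [ladj_cons]
            exact Or.inl ⟨hij, hRij⟩
          intro a ha b hb hab
          rcases Finset.mem_insert.mp ha with rfl | ha
          · rcases Finset.mem_insert.mp hb with rfl | hb
            · exact absurd rfl hab
            · exact ladj_symm R hR _ _ (hadj _ hb)
          · rcases Finset.mem_insert.mp hb with rfl | hb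
            · exact hadj _ ha
            · exact hcl1 _ ha _ hb hab
    have hcol : ∀ i, ∃ c : List (Fin m) → ℕ, (∀ x ∈ part S i, c x < m ^ w) ∧
        (busy i → (part S i).Nonempty → 1 ≤ w) ∧
        (busy i → ∀ x ∈ part S i, c x < m ^ (w - 1)) ∧
        ∀ x ∈ part S i, ∀ y ∈ part S i, ladj R x y → c x ≠ c y := by
      intro i
      by_cases hb : busy i
      · obtain ⟨c, hc1, hc2⟩ := ih (w - 1) (part S i) (hlen i)
          (fun T h1 h2 => by have := (hT i T h1 h2).2 hb; omega)
        refine ⟨c, ?_, ?_, fun _ => hc1, hc2⟩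
        · intro x hx
          exact (hc1 x hx).trans_le (Nat.pow_le_pow_right hm (by omega))
        · intro _ _
          have := (hT i ∅ (by simp) (by simp)).2 hb
          omega
      · obtain ⟨c, hc1, hc2⟩ := ih w (part S i) (hlen i) (fun T h1 h2 => (hT i T h1 h2).1)
        exact ⟨c, hc1, fun h => absurd h hb, fun h => absurd h hb, hc2⟩
    choose c hc1 hc2 hc3 hc4 using hcol
    let C : List (Fin m) → ℕ := fun z => match z with
      | [] => 0
      | i :: x => if busy i then i.val + m * c i x else c i x
    have hC : ∀ i x, C (i :: x) = if busy i then i.val + m * c i x else c i x := fun _ _ => rfl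
    refine ⟨C, ?_, ?_⟩
    · intro z hz
      cases z with
      | nil => simp only [C]; positivity
      | cons i x =>
        have hx := (mem_part _ _ _).mpr hz
        rw [hC]
        split_ifs with hb
        · have h1 := hc2 i hb ⟨x, hx⟩
          have h3 := hc3 i hb x hx
          obtain ⟨w', rfl⟩ : ∃ w', w = w' + 1 := ⟨w - 1, by omega⟩
          simp only [Nat.add_sub_cancel] at h3
          rw [pow_succ]
          have := i.isLt
          nlinarith
        · exact hc1 i x hx
    · intro z hz z' hz' h
      cases z with
      | nil => simp [ladj] at h
      | cons i x =>
        cases z' with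
        | nil => simp [ladj] at h
        | cons j y =>
          have hx := (mem_part _ _ _).mpr hz
          have hy := (mem_part _ _ _).mpr hz'
          rw [ladj_cons] at h
          rw [hC, hC]
          rcases h with ⟨hij, hRij⟩ | ⟨rfl, h⟩
          · have hbi : busy i := ⟨j, hij, hRij, y, hy⟩
            have hbj : busy j := ⟨i, hij.symm, hR _ _ hRij, x, hx⟩
            rw [if_pos hbi, if_pos hbj]
            intro heq
            apply hij
            apply Fin.ext
            have := congrArg (· % m) heq
            simpa [Nat.add_mul_mod_self_left, Nat.mod_eq_of_lt] using this
          · have := hc4 i x hx y hy h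
            split_ifs
            · intro heq
              apply this
              have : m * c i x = m * c i y := by omega
              exact Nat.eq_of_mul_eq_mul_left hm this
            · exact this

/-- The graphs embedding into the infinite power. -/
def PowClass (R : Fin m → Fin m → Prop) : GraphClass := fun n G =>
  ∃ f : Fin n → List (Fin m), Function.Injective f ∧ ∀ a b, G.Adj a b ↔ ladj R (f a) (f b)

lemma powClass_hereditary (R : Fin m → Fin m → Prop) : Hereditary (PowClass R) := by
  rintro n G k H ⟨f, hf, hf'⟩ ⟨φ⟩
  refine ⟨f ∘ φ, hf.comp φ.injective, fun a b => ?_⟩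
  rw [← φ.map_adj_iff, hf']
  rfl

lemma powClass_chiBounded (R : Fin m → Fin m → Prop) (hm : 0 < m)
    (hR : ∀ i j, R i j → R j i) : ChiBounded (PowClass R) := by
  classical
  refine ⟨fun w => (m : ℝ) ^ w, fun n => by positivity, ?_⟩
  rintro n G ⟨f, hf, hf'⟩
  obtain ⟨c, hc1, hc2⟩ := color_pow R hm hR
    ((Finset.univ.image f).sup List.length) G.cliqueNum (Finset.univ.image f)
    (fun x hx => Finset.le_sup (f := List.length) hx) (by
      intro T hT hc
      have hTe : (Finset.univ.filter (fun a => f a ∈ T)).image f = T := by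
        ext x
        simp only [Finset.mem_image, Finset.mem_filter, Finset.mem_univ, true_and]
        constructor
        · rintro ⟨a, ha, rfl⟩; exact ha
        · intro hx
          obtain ⟨a, _, rfl⟩ := Finset.mem_image.mp (hT hx)
          exact ⟨a, hx, rfl⟩
      rw [← hTe, Finset.card_image_of_injective _ hf]
      apply aux_le_clique
      intro a ha b hb hab
      simp only [Finset.coe_filter, Finset.mem_univ, true_and, Set.mem_ofPred_eq] at ha hb
      rw [hf']
      exact hc _ ha _ hb (hf.ne hab))
  have : chromNum G ≤ m ^ G.cliqueNum := by
    apply aux_chrom_le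
    refine ⟨SimpleGraph.Coloring.mk (fun a => ⟨c (f a), hc1 _ (by simp)⟩) ?_⟩
    intro a b hab h
    exact hc2 (f a) (by simp) (f b) (by simp) ((hf' a b).mp hab) (by simpa using h)
  have h4 : (chromNum G : ℝ) ≤ ((m ^ G.cliqueNum : ℕ) : ℝ) := by exact_mod_cast this
  simpa using h4

lemma prime_free (R : Fin m → Fin m → Prop) (P : Fin 5 → Fin 5 → Prop)
    (hP : ∀ h : Fin 5 → Fin m, (∀ a b, h a ≠ h b → (P a b ↔ ¬ R (h a) (h b))) →
      ∀ a, h 0 = h a) :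
    ∀ (k : ℕ) (f : Fin 5 → List (Fin m)), (∀ a, (f a).length = k) → Function.Injective f →
      (∀ a b, a ≠ b → (P a b ↔ ¬ ladj R (f a) (f b))) → False := by
  intro k
  induction k with
  | zero =>
    intro f hl hf _
    have : f 0 = f 1 := by
      rw [List.length_eq_zero_iff.mp (hl 0), List.length_eq_zero_iff.mp (hl 1)]
    exact absurd (hf this) (by decide)
  | succ k ih =>
    intro f hl hf hadj
    have : ∀ a, ∃ i x, f a = i :: x := by
      intro a
      have := hl a
      cases h : f a with
      | nil => rw [h] at this; simp at this
      | cons i x => exact ⟨i, x, rfl⟩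
    choose h t ht using this
    have hconst := hP h (by
      intro a b hab
      rw [hadj a b (fun e => hab (by rw [e])), ht, ht, ladj_cons]
      tauto)
    have hconst' : ∀ a b, h a = h b := fun a b => (hconst a).symm.trans (hconst b)
    apply ih t
    · intro a
      have := hl a
      rw [ht] at this
      simpa using this
    · intro a b hab
      apply hf
      rw [ht, ht, hab, hconst' a b]
    · intro a b hab
      rw [hadj a b hab, ht, ht, ladj_cons]
      have := hconst' a b
      tauto

theorem part_B (R : Fin m → Fin m → Prop) (hR : ∀ i j, R i j → R j i) (s : ℕ) (hs : 0 < s)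
    (hms : 2 * s < m)
    (hcl : ∀ I : Finset (Fin m), (∀ i ∈ I, ∀ j ∈ I, i ≠ j → R i j) → I.card ≤ 2)
    (hst : ∀ I : Finset (Fin m), (∀ i ∈ I, ∀ j ∈ I, i ≠ j → ¬ R i j) → I.card ≤ s)
    (P : Fin 5 → Fin 5 → Prop)
    (hP : ∀ h : Fin 5 → Fin m, (∀ a b, h a ≠ h b → (P a b ↔ ¬ R (h a) (h b))) →
      ∀ a, h 0 = h a)
    (W : Type) [Fintype W] (H : SimpleGraph W)
    (hH : ∀ C : GraphClass, Hereditary C → ChiBounded C →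
      LinearlyChiBounded (fun n G => C n G ∧ IndFree H G))
    (g : Fin 5 → W) (hg : Function.Injective g) (hgP : ∀ a b, P a b ↔ Hᶜ.Adj (g a) (g b)) :
    False := by
  classical
  obtain ⟨B, hB1, hB⟩ := hH _ (powClass_hereditary R) (powClass_chiBounded R (by omega) hR)
  have hs' : (0 : ℝ) < s := by exact_mod_cast hs
  have hratio : 1 < (m : ℝ) / (2 * s) := by
    rw [one_lt_div (by positivity)]
    exact_mod_cast hms
  obtain ⟨k, hk⟩ := pow_unbounded_of_one_lt B hratio
  let e : Fin (m ^ k) ≃ List.Vector (Fin m) k :=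
    (Fintype.equivFinOfCardEq (by rw [card_vector, Fintype.card_fin])).symm
  let f : Fin (m ^ k) → List (Fin m) := fun a => (e a).1
  have hf : Function.Injective f := fun a b h => e.injective (Subtype.ext h)
  have hfl : ∀ a, (f a).length = k := fun a => (e a).2
  let G : SimpleGraph (Fin (m ^ k)) :=
    { Adj := fun a b => ladj R (f a) (f b)
      symm := ⟨fun a b h => ladj_symm R hR _ _ h⟩
      loopless := ⟨fun a h => ladj_irrefl R _ h⟩ }
  have hG : ∀ a b, G.Adj a b ↔ ladj R (f a) (f b) := fun _ _ => Iff.rfl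
  have hfree : IndFree H G := by
    rintro ⟨φ⟩
    refine prime_free R P hP k (fun a => f (φ (g a))) (fun a => hfl _)
      (hf.comp (φ.injective.comp hg)) ?_
    intro a b hab
    rw [hgP, SimpleGraph.compl_adj, ← hG, φ.map_adj_iff]
    have := hg.ne hab
    tauto
  have h1 := hB _ G ⟨⟨f, hf, hG⟩, hfree⟩
  have h2 : G.cliqueNum ≤ 2 ^ k := by
    apply aux_clique_le
    intro S hS
    rw [← Finset.card_image_of_injective S hf]
    apply clique_pow R 2 hcl k
    · intro x hx
      obtain ⟨a, _, rfl⟩ := Finset.mem_image.mp hx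
      exact hfl a
    · intro x hx y hy hxy
      obtain ⟨a, ha, rfl⟩ := Finset.mem_image.mp hx
      obtain ⟨b, hb, rfl⟩ := Finset.mem_image.mp hy
      exact hS ha hb (fun h => hxy (by rw [h]))
  have h3 : m ^ k ≤ chromNum G * s ^ k := by
    apply aux_card_le
    intro S hS
    rw [← Finset.card_image_of_injective S hf]
    apply clique_pow (fun i j => ¬ R i j) s hst k
    · intro x hx
      obtain ⟨a, _, rfl⟩ := Finset.mem_image.mp hx
      exact hfl a
    · intro x hx y hy hxy
      obtain ⟨a, ha, rfl⟩ := Finset.mem_image.mp hx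
      obtain ⟨b, hb, rfl⟩ := Finset.mem_image.mp hy
      exact ladj_not R _ _ ((hfl a).trans (hfl b).symm) hxy (hS a ha b hb)
  have h2R : (G.cliqueNum : ℝ) ≤ 2 ^ k := by exact_mod_cast h2
  have h3R : (m : ℝ) ^ k ≤ chromNum G * (s : ℝ) ^ k := by exact_mod_cast h3
  rw [div_pow, lt_div_iff₀ (by positivity), mul_pow] at hk
  have h4 : (chromNum G : ℝ) ≤ B * 2 ^ k := h1.trans (by gcongr)
  have h5 : (chromNum G : ℝ) * (s : ℝ) ^ k ≤ B * 2 ^ k * (s : ℝ) ^ k := by gcongr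
  linarith

end lists
/-- cycle relation -/
def cyc (m : ℕ) [NeZero m] (i j : Fin m) : Prop := j = i + 1 ∨ i = j + 1

instance (m : ℕ) [NeZero m] (i j : Fin m) : Decidable (cyc m i j) := by
  unfold cyc; infer_instance

/-- path relation -/
def pth (i j : Fin 5) : Prop := i.val + 1 = j.val ∨ j.val + 1 = i.val

instance (i j : Fin 5) : Decidable (pth i j) := by
  unfold pth; infer_instance

lemma cyc5_clique : ∀ I : Finset (Fin 5), (∀ i ∈ I, ∀ j ∈ I, i ≠ j → cyc 5 i j) → I.card ≤ 2 := by
  decide +kernel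
lemma cyc5_stable : ∀ I : Finset (Fin 5), (∀ i ∈ I, ∀ j ∈ I, i ≠ j → ¬ cyc 5 i j) → I.card ≤ 2 := by
  decide +kernel
lemma cyc7_clique : ∀ I : Finset (Fin 7), (∀ i ∈ I, ∀ j ∈ I, i ≠ j → cyc 7 i j) → I.card ≤ 2 := by
  decide +kernel
lemma cyc7_stable : ∀ I : Finset (Fin 7), (∀ i ∈ I, ∀ j ∈ I, i ≠ j → ¬ cyc 7 i j) → I.card ≤ 3 := by
  decide +kernel

/-- compatibility of a pair of images with the cycle relation -/
def okc (m : ℕ) [NeZero m] (P : Prop) (a b : Fin m) : Prop := a ≠ b → (P ↔ ¬ cyc m a b)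

instance (m : ℕ) [NeZero m] (P : Prop) [Decidable P] (a b : Fin m) : Decidable (okc m P a b) := by
  unfold okc; infer_instance

set_option synthInstance.maxHeartbeats 400000 in
set_option synthInstance.maxSize 4000 in
lemma pth_prime_aux : ∀ a b : Fin 5, okc 5 (pth 0 1) a b →
    ∀ c, okc 5 (pth 0 2) a c → okc 5 (pth 1 2) b c →
    ∀ d, okc 5 (pth 0 3) a d → okc 5 (pth 1 3) b d →
      okc 5 (pth 2 3) c d →
    ∀ e, okc 5 (pth 0 4) a e → okc 5 (pth 1 4) b e →
      okc 5 (pth 2 4) c e → okc 5 (pth 3 4) d e →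
    a = b ∧ a = c ∧ a = d ∧ a = e := by
  decide +kernel

set_option synthInstance.maxHeartbeats 400000 in
set_option synthInstance.maxSize 4000 in
lemma cyc_prime_aux : ∀ a b : Fin 7, okc 7 (cyc 5 0 1) a b →
    ∀ c, okc 7 (cyc 5 0 2) a c → okc 7 (cyc 5 1 2) b c →
    ∀ d, okc 7 (cyc 5 0 3) a d → okc 7 (cyc 5 1 3) b d →
      okc 7 (cyc 5 2 3) c d →
    ∀ e, okc 7 (cyc 5 0 4) a e → okc 7 (cyc 5 1 4) b e →
      okc 7 (cyc 5 2 4) c e → okc 7 (cyc 5 3 4) d e →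
    a = b ∧ a = c ∧ a = d ∧ a = e := by
  decide +kernel

lemma pth_prime (h : Fin 5 → Fin 5)
    (hh : ∀ a b, h a ≠ h b → (pth a b ↔ ¬ cyc 5 (h a) (h b))) : ∀ a, h 0 = h a := by
  obtain ⟨h1, h2, h3, h4⟩ := pth_prime_aux (h 0) (h 1) (hh 0 1) (h 2) (hh 0 2) (hh 1 2) (h 3)
    (hh 0 3) (hh 1 3) (hh 2 3) (h 4) (hh 0 4) (hh 1 4) (hh 2 4) (hh 3 4)
  intro a; fin_cases a <;> first | rfl | assumption

lemma cyc_prime (h : Fin 5 → Fin 7)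
    (hh : ∀ a b, h a ≠ h b → (cyc 5 a b ↔ ¬ cyc 7 (h a) (h b))) : ∀ a, h 0 = h a := by
  obtain ⟨h1, h2, h3, h4⟩ := cyc_prime_aux (h 0) (h 1) (hh 0 1) (h 2) (hh 0 2) (hh 1 2) (h 3)
    (hh 0 3) (hh 1 3) (hh 2 3) (h 4) (hh 0 4) (hh 1 4) (hh 2 4) (hh 3 4)
  intro a; fin_cases a <;> first | rfl | assumption

lemma cyc_symm (m : ℕ) [NeZero m] (i j : Fin m) (h : cyc m i j) : cyc m j i := by
  unfold cyc at *; tauto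

theorem part_C (W : Type) [Fintype W] (H : SimpleGraph W)
    (hH : ∀ C : GraphClass, Hereditary C → ChiBounded C →
      LinearlyChiBounded (fun n G => C n G ∧ IndFree H G))
    (g : Fin 5 → W) (hg : Function.Injective g)
    (h01 : Hᶜ.Adj (g 0) (g 1)) (h12 : Hᶜ.Adj (g 1) (g 2)) (h23 : Hᶜ.Adj (g 2) (g 3))
    (h34 : Hᶜ.Adj (g 3) (g 4)) : False := by
  have htri : ∀ a b c, Hᶜ.Adj a b → Hᶜ.Adj a c → Hᶜ.Adj b c → False := fun a b c h1 h2 h3 =>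
    part_A W H hH (Or.inl ⟨a, b, c, h1, h2, h3⟩)
  have hc4 : ∀ a b x y, a ≠ b → x ≠ y → Hᶜ.Adj a x → Hᶜ.Adj b x → Hᶜ.Adj a y → Hᶜ.Adj b y →
      False := fun a b x y h1 h2 h3 h4 h5 h6 =>
    part_A W H hH (Or.inr ⟨a, b, x, y, h1, h2, h3, h4, h5, h6⟩)
  have n02 : ¬ Hᶜ.Adj (g 0) (g 2) := fun h => htri _ _ _ h01 h h12
  have n13 : ¬ Hᶜ.Adj (g 1) (g 3) := fun h => htri _ _ _ h12 h h23
  have n24 : ¬ Hᶜ.Adj (g 2) (g 4) := fun h => htri _ _ _ h23 h h34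
  have n03 : ¬ Hᶜ.Adj (g 0) (g 3) := fun h =>
    hc4 (g 0) (g 2) (g 1) (g 3) (hg.ne (by decide)) (hg.ne (by decide)) h01 h12.symm h h23
  have n14 : ¬ Hᶜ.Adj (g 1) (g 4) := fun h =>
    hc4 (g 1) (g 3) (g 2) (g 4) (hg.ne (by decide)) (hg.ne (by decide)) h12 h23.symm h h34
  by_cases h04 : Hᶜ.Adj (g 0) (g 4)
  · refine part_B (cyc 7) (cyc_symm 7) 3 (by norm_num) (by norm_num) cyc7_clique cyc7_stable
      (cyc 5) cyc_prime W H hH g hg ?_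
    intro a b
    fin_cases a <;> fin_cases b <;>
      simp only [Fin.mk_zero, Fin.mk_one, Fin.reduceFinMk, SimpleGraph.irrefl] <;>
      first
        | exact iff_of_true (by decide) (by first | assumption | (apply SimpleGraph.Adj.symm; assumption))
        | exact iff_of_false (by decide) (by first | assumption | exact id | (intro h; have := h.symm; contradiction))
  · refine part_B (cyc 5) (cyc_symm 5) 2 (by norm_num) (by norm_num) cyc5_clique cyc5_stable
      pth pth_prime W H hH g hg ?_
    intro a b
    fin_cases a <;> fin_cases b <;>
      simp only [Fin.mk_zero, Fin.mk_one, Fin.reduceFinMk, SimpleGraph.irrefl] <;>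
      first
        | exact iff_of_true (by decide) (by first | assumption | (apply SimpleGraph.Adj.symm; assumption))
        | exact iff_of_false (by decide) (by first | assumption | exact id | (intro h; have := h.symm; contradiction))

/-- if `H` is a graph such that for every χ-bounded hereditary
class `C` the class of `H`-free graphs in `C` is linearly χ-bounded, then the
complement of `H` is a forest with no induced `P_5`. -/
theorem stmt16 (W : Type) [Fintype W] (H : SimpleGraph W)
    (hH : ∀ C : GraphClass, Hereditary C → ChiBounded C →
      LinearlyChiBounded (fun n G => C n G ∧ IndFree H G)) :
    Hᶜ.IsAcyclic ∧ IndFree (SimpleGraph.pathGraph 5) Hᶜ := by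
  constructor
  · intro v c hc
    have hinj := hc.getVert_injOn'
    have h3 := hc.three_le_length
    have hadj : ∀ i, i < c.length → Hᶜ.Adj (c.getVert i) (c.getVert (i + 1)) :=
      fun i hi => c.adj_getVert_succ hi
    have hne : ∀ i j, i < c.length → j < c.length → i ≠ j → c.getVert i ≠ c.getVert j := by
      intro i j hi hj hij h
      apply hij
      apply hinj _ _ h <;> simp <;> omega
    have hend : c.getVert c.length = c.getVert 0 := by simp
    rcases Nat.lt_or_ge c.length 5 with h5 | h5
    · have h34 : c.length = 3 ∨ c.length = 4 := by omega
      rcases h34 with h | h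
      · refine part_A W H hH (Or.inl ⟨c.getVert 0, c.getVert 1, c.getVert 2,
          hadj 0 (by omega), ?_, hadj 1 (by omega)⟩)
        have := hadj 2 (by omega)
        rw [h] at hend
        rw [hend] at this
        exact this.symm
      · refine part_A W H hH (Or.inr ⟨c.getVert 0, c.getVert 2, c.getVert 1, c.getVert 3,
          hne _ _ (by omega) (by omega) (by omega), hne _ _ (by omega) (by omega) (by omega),
          hadj 0 (by omega), (hadj 1 (by omega)).symm, ?_, hadj 2 (by omega)⟩)
        have := hadj 3 (by omega)
        rw [h] at hend
        rw [hend] at this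
        exact this.symm
    · refine part_C W H hH (fun i => c.getVert i.val) ?_ (hadj 0 (by omega)) (hadj 1 (by omega))
        (hadj 2 (by omega)) (hadj 3 (by omega))
      intro i j hij
      by_contra hcon
      exact hne i.val j.val (by omega) (by omega) (fun h => hcon (Fin.ext h)) hij
  · rintro ⟨φ⟩
    refine part_C W H hH φ φ.injective ?_ ?_ ?_ ?_ <;>
      rw [φ.map_adj_iff, SimpleGraph.pathGraph_adj] <;> simp
end
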